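/- Consider the semilinear evolution equation ẋ(t)=Ax(t)+f(x(t),u(t)) on a Banach space X with mild solutions, satisfying Assumption 1 and property ◊. If this system has bounded reachability sets (BRS) and there exists a non-coercive ISS Lyapunov function for it, then the system is ISS. -/

import Mathlib

open Set Filter

/-- Class `K`: continuous, strictly increasing on `[0,∞)` and vanishing at `0`. -/
def ClassK (γ : ℝ → ℝ) : Prop :=
  ContinuousOn γ (Ici 0) ∧ StrictMonoOn γ (Ici 0) ∧ γ 0 = 0

/-- Class `K∞`: class `K` and unbounded. -/
def ClassKinf (γ : ℝ → ℝ) : Prop :=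
  ClassK γ ∧ ∀ c : ℝ, ∃ r : ℝ, 0 ≤ r ∧ c ≤ γ r

/-- The class `K∞ ∪ {0}`. -/
def ClassKinf0 (γ : ℝ → ℝ) : Prop :=
  ClassKinf γ ∨ ∀ r : ℝ, 0 ≤ r → γ r = 0

/-- The class `K ∪ {0}`. -/
def ClassK0 (γ : ℝ → ℝ) : Prop :=
  ClassK γ ∨ ∀ r : ℝ, 0 ≤ r → γ r = 0

/-- Class `L`: continuous, strictly decreasing on `[0,∞)` with limit `0` at infinity. -/
def ClassL (γ : ℝ → ℝ) : Prop :=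
  ContinuousOn γ (Ici 0) ∧ StrictAntiOn γ (Ici 0) ∧ Tendsto γ atTop (nhds 0)

/-- Class `KL`. -/
def ClassKL (β : ℝ → ℝ → ℝ) : Prop :=
  ContinuousOn (fun p : ℝ × ℝ => β p.1 p.2) ((Ici 0) ×ˢ (Ici 0)) ∧
  (∀ t : ℝ, 0 ≤ t → ClassK (fun r => β r t)) ∧
  ∀ r : ℝ, 0 < r → StrictAntiOn (β r) (Ici 0) ∧ Tendsto (β r) atTop (nhds 0)

/-- A strongly continuous semigroup of bounded linear operators on `X`. -/
structure C0Semigroup (X : Type*) [NormedAddCommGroup X] [NormedSpace ℝ X] where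
  /-- the semigroup operators -/
  T : ℝ → X →L[ℝ] X
  map_zero' : T 0 = ContinuousLinearMap.id ℝ X
  semigroup' : ∀ s : ℝ, 0 ≤ s → ∀ t : ℝ, 0 ≤ t → T (s + t) = (T s).comp (T t)
  strong_cont : ∀ x : X, ContinuousOn (fun t => T t x) (Ici 0)

variable {X U : Type*} [NormedAddCommGroup X] [NormedSpace ℝ X] [CompleteSpace X]
  [NormedAddCommGroup U] [NormedSpace ℝ U]

/-- A member of `PC(ℝ₊, U)`: a globally bounded, piecewise continuous,
right-continuous input function (modelled on `ℝ`, only `t ≥ 0` relevant). -/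
def PCin (u : ℝ → U) : Prop :=
  (∃ C : ℝ, ∀ t : ℝ, 0 ≤ t → ‖u t‖ ≤ C) ∧
  (∀ t : ℝ, 0 ≤ t → ContinuousWithinAt u (Ici t) t) ∧
  (∀ T : ℝ, 0 < T → ∃ D : Finset ℝ, ∀ t ∈ Icc (0:ℝ) T, t ∉ D →
    ContinuousWithinAt u (Ici 0) t)

/-- The sup-norm of an input: `‖u‖_𝒰 = sup_{t ≥ 0} ‖u(t)‖`. -/
noncomputable def pcNorm (u : ℝ → U) : ℝ :=
  ⨆ t : Ici (0:ℝ), ‖u t.val‖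

/-- The mild-solution property: `φ` assigns to each initial state and each admissible
input the (unique, globally defined) mild solution of `ẋ = Ax + f(x,u)`, i.e.
`x(t) = T(t)x(0) + ∫₀ᵗ T(t-s) f(x(s), u(s)) ds`, which is continuous in time. -/
def IsMildFlow (Tg : C0Semigroup X) (f : X → U → X)
    (φ : ℝ → X → (ℝ → U) → X) : Prop :=
  ∀ (x : X) (u : ℝ → U), PCin u →
    (∀ t : ℝ, 0 ≤ t →
      φ t x u = Tg.T t x + ∫ s in (0:ℝ)..t, Tg.T (t - s) (f (φ s x u) (u s))) ∧
    ContinuousOn (fun t => φ t x u) (Ici 0)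

/-- Assumption 1: `f` is Lipschitz continuous on bounded subsets of `X`, uniformly
with respect to the second argument; `f(x,·)` is continuous and `f(0,0) = 0`. -/
def Assumption1 (f : X → U → X) : Prop :=
  (∀ C : ℝ, 0 < C → ∃ L : ℝ, 0 ≤ L ∧ ∀ x y : X, ‖x‖ ≤ C → ‖y‖ ≤ C → ∀ v : U,
    ‖f x v - f y v‖ ≤ L * ‖x - y‖) ∧
  (∀ x : X, Continuous (f x)) ∧ f 0 0 = 0

/-- Property `◊`: there exist `σ ∈ K` and `r > 0` such that
`‖f(x,v) - f(x,0)‖ ≤ σ(‖v‖)` for all `‖v‖ < r` and `‖x‖ ≤ r`. -/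
def PropertyDiamond (f : X → U → X) : Prop :=
  ∃ σ, ClassK σ ∧ ∃ r : ℝ, 0 < r ∧ ∀ v : U, ‖v‖ < r → ∀ x : X, ‖x‖ ≤ r →
    ‖f x v - f x 0‖ ≤ σ ‖v‖

/-- ISS of the system with flow `φ`. -/
def pISS (φ : ℝ → X → (ℝ → U) → X) : Prop :=
  ∃ β γ, ClassKL β ∧ ClassK γ ∧
    ∀ x : X, ∀ u : ℝ → U, PCin u → ∀ t : ℝ, 0 ≤ t →
      ‖φ t x u‖ ≤ β ‖x‖ t + γ (pcNorm u)

/-- UAG of the system with flow `φ`. -/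
def pUAG (φ : ℝ → X → (ℝ → U) → X) : Prop :=
  ∃ γ, ClassKinf0 γ ∧
    ∀ ε : ℝ, 0 < ε → ∀ r : ℝ, 0 < r → ∃ τ : ℝ, 0 ≤ τ ∧
      ∀ u : ℝ → U, PCin u → ∀ x : X, ‖x‖ < r → ∀ t : ℝ, τ ≤ t →
        ‖φ t x u‖ ≤ ε + γ (pcNorm u)

/-- BRS of the system with flow `φ`. -/
def pBRS (φ : ℝ → X → (ℝ → U) → X) : Prop :=
  ∀ C : ℝ, 0 < C → ∀ τ : ℝ, 0 < τ → ∃ M : ℝ,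
    ∀ x : X, ‖x‖ ≤ C → ∀ u : ℝ → U, PCin u → pcNorm u ≤ C → ∀ t ∈ Icc (0:ℝ) τ,
      ‖φ t x u‖ ≤ M

/-- ULIM of the system with flow `φ`. -/
def pULIM (φ : ℝ → X → (ℝ → U) → X) : Prop :=
  ∃ γ, ClassK0 γ ∧
    ∀ ε : ℝ, 0 < ε → ∀ r : ℝ, 0 < r → ∃ τ : ℝ, 0 ≤ τ ∧
      ∀ x : X, ‖x‖ ≤ r → ∀ u : ℝ → U, PCin u → ∃ t ∈ Icc (0:ℝ) τ,
        ‖φ t x u‖ ≤ ε + γ (pcNorm u)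

/-- ULS of the system with flow `φ`. -/
def pULS (φ : ℝ → X → (ℝ → U) → X) : Prop :=
  ∃ σ γ, ClassKinf σ ∧ ClassKinf0 γ ∧ ∃ r : ℝ, 0 < r ∧
    ∀ t : ℝ, 0 ≤ t → ∀ x : X, ‖x‖ ≤ r → ∀ u : ℝ → U, PCin u → pcNorm u ≤ r →
      ‖φ t x u‖ ≤ σ ‖x‖ + γ (pcNorm u)

/-- UGS of the system with flow `φ`. -/
def pUGS (φ : ℝ → X → (ℝ → U) → X) : Prop :=
  ∃ σ γ, ClassKinf σ ∧ ClassKinf0 γ ∧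
    ∀ t : ℝ, 0 ≤ t → ∀ x : X, ∀ u : ℝ → U, PCin u →
      ‖φ t x u‖ ≤ σ ‖x‖ + γ (pcNorm u)

/-- 0-ULS (uniform local stability of the undisturbed system) with flow `φ`. -/
def pZeroULS (φ : ℝ → X → (ℝ → U) → X) : Prop :=
  ∃ σ, ClassKinf σ ∧ ∃ r : ℝ, 0 < r ∧
    ∀ x : X, ‖x‖ ≤ r → ∀ t : ℝ, 0 ≤ t → ‖φ t x (fun _ => 0)‖ ≤ σ ‖x‖

/-- The Dini derivative of `V` along the trajectories of the flow `φ`, computed in the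
extended reals. -/
noncomputable def pDiniLimsup (φ : ℝ → X → (ℝ → U) → X) (V : X → ℝ)
    (x : X) (u : ℝ → U) : EReal :=
  Filter.limsup (fun t : ℝ => (((V (φ t x u) - V x) / t : ℝ) : EReal))
    (nhdsWithin (0:ℝ) (Ioi 0))

/-- A non-coercive ISS Lyapunov function for the system with flow `φ`. -/
def pNonCoerciveISSLyapunov (φ : ℝ → X → (ℝ → U) → X) (V : X → ℝ) : Prop :=
  Continuous V ∧ (∀ x : X, 0 ≤ V x) ∧
  ∃ ψ₂ α σ, ClassKinf ψ₂ ∧ ClassKinf α ∧ ClassK σ ∧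
    (∀ x : X, x ≠ 0 → 0 < V x) ∧ (∀ x : X, V x ≤ ψ₂ ‖x‖) ∧
    ∀ x : X, ∀ u : ℝ → U, PCin u →
      pDiniLimsup φ V x u ≤ ((-α ‖x‖ + σ (pcNorm u) : ℝ) : EReal)

set_option linter.unusedSectionVars false
set_option linter.unusedVariables false

lemma ClassK.nonneg {γ : ℝ → ℝ} (h : ClassK γ) {r : ℝ} (hr : 0 ≤ r) : 0 ≤ γ r := by
  have := h.2.1.monotoneOn (mem_Ici.2 le_rfl) (mem_Ici.2 hr) hr
  rwa [h.2.2] at this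

lemma ClassK.pos {γ : ℝ → ℝ} (h : ClassK γ) {r : ℝ} (hr : 0 < r) : 0 < γ r := by
  have := h.2.1 (mem_Ici.2 le_rfl) (mem_Ici.2 hr.le) hr
  rwa [h.2.2] at this

lemma ClassK.mono {γ : ℝ → ℝ} (h : ClassK γ) {r s : ℝ} (hr : 0 ≤ r) (hrs : r ≤ s) : γ r ≤ γ s :=
  h.2.1.monotoneOn (mem_Ici.2 hr) (mem_Ici.2 (hr.trans hrs)) hrs

lemma ClassK.le_of_le {γ : ℝ → ℝ} (h : ClassK γ) {r s : ℝ} (hr : 0 ≤ r) (hs : 0 ≤ s)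
    (hrs : γ r ≤ γ s) : r ≤ s :=
  (h.2.1.le_iff_le (mem_Ici.2 hr) (mem_Ici.2 hs)).1 hrs

lemma ClassK.small {γ : ℝ → ℝ} (h : ClassK γ) {ε : ℝ} (hε : 0 < ε) :
    ∃ δ : ℝ, 0 < δ ∧ ∀ r, 0 ≤ r → r ≤ δ → γ r ≤ ε := by
  have h1 : Tendsto γ (nhdsWithin 0 (Ici 0)) (nhds 0) := by
    have := h.1 0 (mem_Ici.2 le_rfl)
    rwa [ContinuousWithinAt, h.2.2] at this
  have h2 := h1.eventually (gt_mem_nhds hε)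
  rw [eventually_nhdsWithin_iff, Metric.eventually_nhds_iff] at h2
  obtain ⟨δ, hδ, h3⟩ := h2
  refine ⟨δ / 2, by positivity, fun r hr hrd => (h3 ?_ hr).le⟩
  rw [Real.dist_eq, sub_zero, abs_of_nonneg hr]; linarith

lemma exists_Kinf_bound {ι : Type*} (a y : ι → ℝ) (ha : ∀ i, 0 ≤ a i)
    (hb : ∀ C : ℝ, 0 < C → ∃ M : ℝ, ∀ i, a i ≤ C → y i ≤ M)
    (hs : ∀ ε : ℝ, 0 < ε → ∃ δ : ℝ, 0 < δ ∧ ∀ i, a i ≤ δ → y i ≤ ε) :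
    ∃ θ, ClassKinf θ ∧ ∀ i, y i ≤ θ (a i) := by
  classical
  set A : ℝ → Set ℝ := fun c => insert 0 {z | ∃ i, a i ≤ c ∧ z = y i} with hA
  set S : ℝ → ℝ := fun c => sSup (A c) with hS
  have bdd : ∀ c, BddAbove (A c) := by
    intro c
    obtain ⟨M, hM⟩ := hb (max c 1) (by positivity)
    refine ⟨max M 0, ?_⟩
    rintro z (rfl | ⟨i, hi, rfl⟩)
    · exact le_max_right _ _
    · exact (hM i (hi.trans (le_max_left _ _))).trans (le_max_left _ _)
  have S0 : ∀ c, 0 ≤ S c := fun c => le_csSup (bdd c) (mem_insert _ _)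
  have Sy : ∀ i c, a i ≤ c → y i ≤ S c := fun i c h =>
    le_csSup (bdd c) (mem_insert_of_mem _ ⟨i, h, rfl⟩)
  have Smono : Monotone S := by
    intro c d hcd
    refine csSup_le_csSup (bdd d) ⟨0, mem_insert _ _⟩ ?_
    rintro z (rfl | ⟨i, hi, rfl⟩)
    · exact mem_insert _ _
    · exact mem_insert_of_mem _ ⟨i, hi.trans hcd, rfl⟩
  have Ssmall : ∀ ε, 0 < ε → ∃ δ, 0 < δ ∧ S δ ≤ ε := by
    intro ε hε
    obtain ⟨δ, hδ, h⟩ := hs ε hε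
    refine ⟨δ, hδ, csSup_le ⟨0, mem_insert _ _⟩ ?_⟩
    rintro z (rfl | ⟨i, hi, rfl⟩)
    · exact hε.le
    · exact h i hi
  have Szero : S 0 = 0 := by
    refine le_antisymm (le_of_forall_pos_le_add fun ε hε => ?_) (S0 0)
    obtain ⟨δ, hδ, h⟩ := Ssmall ε hε
    linarith [Smono hδ.le]
  have Sint : ∀ p q, IntervalIntegrable S MeasureTheory.volume p q := fun p q =>
    Smono.intervalIntegrable
  have Sint' : ∀ r : ℝ, 0 ≤ r → ∀ p q,
      IntervalIntegrable (fun s => S (r * s)) MeasureTheory.volume p q := fun r hr p q =>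
    Monotone.intervalIntegrable (fun x z hxz => Smono (by gcongr))
  set P : ℝ → ℝ := fun r => ∫ s in (1:ℝ)..2, S (r * s) with hP
  have Plow : ∀ r, 0 ≤ r → S r ≤ P r := by
    intro r hr
    have : ∫ s in (1:ℝ)..2, S r ≤ P r := by
      refine intervalIntegral.integral_mono_on (by norm_num) (by simp) (Sint' r hr _ _) ?_
      intro s hs
      exact Smono (by nlinarith [hs.1])
    simp at this; linarith
  have Phigh : ∀ r, 0 ≤ r → P r ≤ S (2 * r) := by
    intro r hr
    have : P r ≤ ∫ s in (1:ℝ)..2, S (2 * r) := by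
      refine intervalIntegral.integral_mono_on (by norm_num) (Sint' r hr _ _) (by simp) ?_
      intro s hs
      exact Smono (by nlinarith [hs.2])
    simp at this; linarith
  have Pmono : ∀ r s, 0 ≤ r → r ≤ s → P r ≤ P s := by
    intro r s hr hrs
    refine intervalIntegral.integral_mono_on (by norm_num) (Sint' r hr _ _)
      (Sint' s (hr.trans hrs) _ _) ?_
    intro t ht
    exact Smono (by nlinarith [ht.1])
  have Pzero : P 0 = 0 := by simp [hP, Szero]
  have Pcont : ContinuousOn P (Ici 0) := by
    intro r hr
    rcases (mem_Ici.1 hr).eq_or_lt with h0 | h0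
    · subst h0
      rw [ContinuousWithinAt, Pzero, Metric.tendsto_nhdsWithin_nhds]
      intro ε hε
      obtain ⟨δ, hδ, h⟩ := Ssmall (ε / 2) (by positivity)
      refine ⟨δ / 2, by positivity, fun {x} hx hxd => ?_⟩
      have hx0 : 0 ≤ x := hx
      rw [Real.dist_eq, sub_zero, abs_of_nonneg hx0] at hxd
      have h1 := Plow x hx0
      have h2 := S0 x
      have h3 := Phigh x hx0
      have h4 : S (2 * x) ≤ S δ := Smono (by linarith)
      rw [Real.dist_eq, sub_zero, abs_of_nonneg (h2.trans h1)]
      linarith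
    · have hc : Continuous fun b => ∫ x in (0:ℝ)..b, S x :=
        intervalIntegral.continuous_primitive Sint 0
      have hc2 : ContinuousAt (fun r : ℝ => r⁻¹ * ((∫ x in (0:ℝ)..(r * 2), S x)
          - ∫ x in (0:ℝ)..(r * 1), S x)) r := by
        refine (continuousAt_inv₀ h0.ne').mul ?_
        have e1 : Continuous fun r : ℝ => ∫ x in (0:ℝ)..(r * 2), S x :=
          hc.comp (continuous_id.mul continuous_const)
        have e2 : Continuous fun r : ℝ => ∫ x in (0:ℝ)..(r * 1), S x :=
          hc.comp (continuous_id.mul continuous_const)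
        exact (e1.sub e2).continuousAt
      refine (hc2.congr ?_).continuousWithinAt
      filter_upwards [lt_mem_nhds h0] with t ht
      rw [intervalIntegral.integral_interval_sub_left (Sint _ _) (Sint _ _)]
      simp only [hP]
      rw [intervalIntegral.integral_comp_mul_left (fun x => S x) ht.ne', smul_eq_mul]
  refine ⟨fun r => r + P r, ⟨⟨continuousOn_id.add Pcont, ?_, by simp [Pzero]⟩, ?_⟩, ?_⟩
  · intro r hr s hs hrs
    exact add_lt_add_of_lt_of_le hrs (Pmono r s hr hrs.le)
  · intro c
    refine ⟨max c 0, le_max_right _ _, ?_⟩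
    have h1 := Plow (max c 0) (le_max_right _ _)
    have h2 := S0 (max c 0)
    have h3 := le_max_left c 0
    simp only; linarith
  · intro i
    have h1 := Plow _ (ha i)
    have h2 := Sy i _ le_rfl
    have h3 := ha i
    simp only; linarith

lemma integral_gronwall {d : ℝ → ℝ} {c K τ : ℝ} (hK : 0 ≤ K)
    (hd : ContinuousOn d (Icc 0 τ))
    (h : ∀ t ∈ Icc 0 τ, d t ≤ c + K * ∫ s in (0:ℝ)..t, d s) :
    ∀ t ∈ Icc 0 τ, d t ≤ c * Real.exp (K * t) := by
  intro t ht
  have hτ : 0 ≤ τ := ht.1.trans ht.2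
  -- extend d continuously
  set e : ℝ → ℝ := IccExtend hτ (domRestrict (Icc 0 τ) d) with he
  have hec : Continuous e := (continuousOn_iff_continuous_domRestrict.1 hd).Icc_extend'
  have hee : ∀ s ∈ Icc 0 τ, e s = d s := fun s hs => by
    rw [he, IccExtend_of_mem _ _ hs]; rfl
  have hint : ∀ s ∈ Icc 0 τ, ∫ r in (0:ℝ)..s, d r = ∫ r in (0:ℝ)..s, e r := by
    intro s hs
    refine intervalIntegral.integral_congr fun r hr => ?_
    rw [uIcc_of_le hs.1] at hr
    exact (hee r ⟨hr.1, hr.2.trans hs.2⟩).symm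
  set J : ℝ → ℝ := fun s => ∫ r in (0:ℝ)..s, e r with hJ
  have hJd : ∀ s, HasDerivAt J (e s) s := fun s =>
    intervalIntegral.integral_hasDerivAt_right (hec.intervalIntegrable _ _)
      (hec.stronglyMeasurableAtFilter _ _) hec.continuousAt
  set H : ℝ → ℝ := fun s => Real.exp (-(K * s)) * (c + K * J s) with hH
  have hHd : ∀ s, HasDerivAt H (-(K * 1) * Real.exp (-(K * s)) * (c + K * J s)
      + Real.exp (-(K * s)) * (K * e s)) s := by
    intro s
    have h1 : HasDerivAt (fun s : ℝ => Real.exp (-(K * s))) (Real.exp (-(K * s)) * (-(K * 1))) s :=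
      (((hasDerivAt_id s).const_mul K).neg).exp
    have h2 : HasDerivAt (fun s => c + K * J s) (K * e s) s := ((hJd s).const_mul K).const_add c
    exact (h1.mul h2).congr_deriv (by ring)
  have hanti : AntitoneOn H (Icc 0 τ) := by
    refine antitoneOn_of_deriv_nonpos (convex_Icc _ _)
      (fun s _ => (hHd s).continuousAt.continuousWithinAt)
      (fun s _ => (hHd s).differentiableAt.differentiableWithinAt) ?_
    intro s hs
    rw [interior_Icc] at hs
    have hs' : s ∈ Icc 0 τ := ⟨hs.1.le, hs.2.le⟩
    rw [(hHd s).deriv]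
    have h1 := h s hs'
    rw [hint s hs', ← hee s hs'] at h1
    have h2 : 0 ≤ Real.exp (-(K * s)) * K * (c + K * J s - e s) :=
      mul_nonneg (by positivity) (by linarith)
    nlinarith
  have h1 := hanti ⟨le_rfl, hτ⟩ ht ht.1
  have h2 : H 0 = c := by simp [hH, hJ]
  have h3 := h t ht
  rw [hint t ht] at h3
  rw [h2] at h1
  have h4 : c + K * J t = H t * Real.exp (K * t) := by
    simp only [hH]
    rw [mul_right_comm, ← Real.exp_add]; simp
  calc d t ≤ c + K * J t := h3
    _ = H t * Real.exp (K * t) := h4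
    _ ≤ c * Real.exp (K * t) := by gcongr

lemma sg_bound (Tg : C0Semigroup X) (τ : ℝ) :
    ∃ M : ℝ, 1 ≤ M ∧ ∀ t ∈ Icc 0 τ, ∀ x : X, ‖Tg.T t x‖ ≤ M * ‖x‖ := by
  obtain ⟨C, hC⟩ := banach_steinhaus (g := fun t : Icc (0:ℝ) τ => Tg.T t.1) (by
    intro x
    have hc : ContinuousOn (fun t => Tg.T t x) (Icc 0 τ) :=
      (Tg.strong_cont x).mono Icc_subset_Ici_self
    obtain ⟨C, hC⟩ := isCompact_Icc.exists_bound_of_continuousOn hc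
    exact ⟨C, fun i => hC i.1 i.2⟩)
  refine ⟨max C 1, le_max_right _ _, fun t ht x => ?_⟩
  refine ((Tg.T t).le_opNorm x).trans ?_
  gcongr
  exact (hC ⟨t, ht⟩).trans (le_max_left _ _)

lemma sg_tendsto (Tg : C0Semigroup X) {β : Type*} {l : Filter β} {r : β → ℝ} {h : β → X} {r0 : ℝ}
    {h0 : X} (hr0 : 0 ≤ r0) (hr : Tendsto r l (nhdsWithin r0 (Ici 0)))
    (hh : Tendsto h l (nhds h0)) :
    Tendsto (fun s => Tg.T (r s) (h s)) l (nhds (Tg.T r0 h0)) := by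
  obtain ⟨M, hM1, hM⟩ := sg_bound Tg (r0 + 1)
  have h1 : Tendsto (fun s => Tg.T (r s) h0) l (nhds (Tg.T r0 h0)) :=
    (Tg.strong_cont h0 r0 (mem_Ici.2 hr0)).tendsto.comp hr
  have h2 : Tendsto (fun s => Tg.T (r s) (h s - h0)) l (nhds 0) := by
    rw [tendsto_zero_iff_norm_tendsto_zero]
    have h3 : Tendsto (fun s => M * ‖h s - h0‖) l (nhds 0) := by
      have := (tendsto_sub_nhds_zero_iff.2 hh).norm.const_mul M
      simpa using this
    refine squeeze_zero' (Eventually.of_forall fun _ => norm_nonneg _) ?_ h3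
    have e1 : ∀ᶠ s in l, r s < r0 + 1 :=
      (hr.mono_right nhdsWithin_le_nhds).eventually (gt_mem_nhds (by linarith))
    have e2 : ∀ᶠ s in l, r s ∈ Ici (0:ℝ) := hr.eventually self_mem_nhdsWithin
    filter_upwards [e1, e2] with s hs1 hs2
    exact hM _ ⟨hs2, hs1.le⟩ _
  have := h1.add h2
  simpa using this

lemma f_tendsto {f : X → U → X} (hA1 : Assumption1 f) {β : Type*} {l : Filter β} {z : β → X}
    {w : β → U} {x : X} {v : U} (hz : Tendsto z l (nhds x)) (hw : Tendsto w l (nhds v)) :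
    Tendsto (fun s => f (z s) (w s)) l (nhds (f x v)) := by
  obtain ⟨L, hL0, hL⟩ := hA1.1 (‖x‖ + 1) (by positivity)
  have h1 : Tendsto (fun s => f x (w s)) l (nhds (f x v)) :=
    ((hA1.2.1 x).tendsto v).comp hw
  have h2 : Tendsto (fun s => f (z s) (w s) - f x (w s)) l (nhds 0) := by
    rw [tendsto_zero_iff_norm_tendsto_zero]
    have h3 : Tendsto (fun s => L * ‖z s - x‖) l (nhds 0) := by
      have := (tendsto_sub_nhds_zero_iff.2 hz).norm.const_mul L
      simpa using this
    refine squeeze_zero' (Eventually.of_forall fun _ => norm_nonneg _) ?_ h3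
    have e1 : ∀ᶠ s in l, ‖z s‖ < ‖x‖ + 1 := hz.norm.eventually (gt_mem_nhds (by linarith))
    filter_upwards [e1] with s hs1
    exact hL _ _ hs1.le (by linarith) _
  have := h1.add h2
  simpa using this

/-- shifted input -/
def shiftIn (t0 : ℝ) (u : ℝ → U) : ℝ → U := fun t => u (t0 + t)

lemma shiftIn_shiftIn (a b : ℝ) (u : ℝ → U) : shiftIn b (shiftIn a u) = shiftIn (a + b) u := by
  funext t; simp [shiftIn, add_assoc]

lemma shiftIn_zero (u : ℝ → U) : shiftIn 0 u = u := by
  funext t; simp [shiftIn]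

lemma PCin.shift {u : ℝ → U} (hu : PCin u) {t0 : ℝ} (h0 : 0 ≤ t0) : PCin (shiftIn t0 u) := by
  obtain ⟨⟨C, hC⟩, h2, h3⟩ := hu
  refine ⟨⟨C, fun t ht => hC _ (by linarith)⟩, fun t ht => ?_, fun T hT => ?_⟩
  · refine ContinuousWithinAt.comp (t := Ici (t0 + t)) (h2 (t0 + t) (by linarith))
      (by fun_prop) ?_
    intro s hs
    simp only [mem_Ici] at hs ⊢; linarith
  · obtain ⟨D, hD⟩ := h3 (t0 + T) (by linarith)
    refine ⟨D.image (fun s => s - t0), fun t ht htD => ?_⟩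
    refine ContinuousWithinAt.comp (t := Ici 0) (hD (t0 + t) ⟨by linarith [ht.1], by linarith [ht.2]⟩
      ?_) (by fun_prop) ?_
    · intro h
      exact htD (Finset.mem_image.2 ⟨_, h, by ring⟩)
    · intro s hs
      simp only [mem_Ici] at hs ⊢; linarith

lemma PCin.bdd {u : ℝ → U} (hu : PCin u) : BddAbove (range fun t : Ici (0:ℝ) => ‖u t.val‖) := by
  obtain ⟨⟨C, hC⟩, -⟩ := hu
  exact ⟨C, by rintro _ ⟨t, rfl⟩; exact hC _ t.2⟩

lemma PCin.le_norm {u : ℝ → U} (hu : PCin u) {t : ℝ} (ht : 0 ≤ t) : ‖u t‖ ≤ pcNorm u :=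
  le_ciSup hu.bdd (⟨t, ht⟩ : Ici (0:ℝ))

lemma pcNorm_nonneg (u : ℝ → U) : 0 ≤ pcNorm u := Real.iSup_nonneg fun _ => norm_nonneg _

lemma PCin.shift_norm {u : ℝ → U} (hu : PCin u) {t0 : ℝ} (h0 : 0 ≤ t0) :
    pcNorm (shiftIn t0 u) ≤ pcNorm u := by
  have : Nonempty (Ici (0:ℝ)) := ⟨⟨0, mem_Ici.2 le_rfl⟩⟩
  exact ciSup_le fun t => hu.le_norm (by have := t.2; simp only [mem_Ici] at this; linarith)

lemma PCin_zero : PCin (fun _ : ℝ => (0:U)) :=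
  ⟨⟨0, fun t _ => by simp⟩, fun t _ => continuousWithinAt_const,
    fun T _ => ⟨∅, fun t _ _ => continuousWithinAt_const⟩⟩

lemma pcNorm_zero : pcNorm (fun _ : ℝ => (0:U)) = 0 := by simp [pcNorm]

lemma mild_meas (Tg : C0Semigroup X) {f : X → U → X} (hA1 : Assumption1 f) {z : ℝ → X}
    (hz : ContinuousOn z (Ici 0)) {u : ℝ → U} (hu : PCin u) {t : ℝ} :
    MeasureTheory.AEStronglyMeasurable (fun s => Tg.T (t - s) (f (z s) (u s)))
      (MeasureTheory.volume.restrict (Icc 0 t)) := by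
  obtain ⟨D, hD⟩ := hu.2.2 (max t 1) (by positivity)
  have hc : ContinuousOn (fun s => Tg.T (t - s) (f (z s) (u s))) (Icc 0 t \ (D : Set ℝ)) := by
    intro s hs
    have hs1 : s ∈ Icc 0 t := hs.1
    refine sg_tendsto Tg (by linarith [hs1.2]) ?_ (f_tendsto hA1 ?_ ?_)
    · refine tendsto_nhdsWithin_iff.2 ⟨?_, ?_⟩
      · have : Continuous fun s : ℝ => t - s := by fun_prop
        exact this.continuousWithinAt
      · filter_upwards [self_mem_nhdsWithin] with r hr
        have : r ∈ Icc 0 t := hr.1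
        exact mem_Ici.2 (by linarith [this.2])
    · exact (hz s hs1.1).mono (fun r hr => hr.1.1)
    · exact (hD s ⟨hs1.1, hs1.2.trans (le_max_left _ _)⟩ hs.2).mono (fun r hr => hr.1.1)
  have hm := hc.aestronglyMeasurable (μ := MeasureTheory.volume)
    (measurableSet_Icc.diff D.measurableSet)
  have : (MeasureTheory.volume.restrict (Icc 0 t \ (D : Set ℝ)))
      = MeasureTheory.volume.restrict (Icc 0 t) := by
    refine MeasureTheory.Measure.restrict_congr_set ?_
    exact MeasureTheory.sdiff_null_ae_eq_self (D.measure_zero _)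
  rwa [this] at hm

/-- good times of an input -/
def GoodT (Tg : C0Semigroup X) (f : X → U → X) (u : ℝ → U) (t : ℝ) : Prop :=
  IntervalIntegrable (fun s => Tg.T (t - s) (f 0 (u s))) MeasureTheory.volume 0 t

lemma diff_bound (Tg : C0Semigroup X) {f : X → U → X} (hA1 : Assumption1 f) (τ C : ℝ) :
    ∃ K, 0 ≤ K ∧ ∀ x y : X, ‖x‖ ≤ C → ‖y‖ ≤ C → ∀ v : U, ∀ t ∈ Icc 0 τ,
      ‖Tg.T t (f x v) - Tg.T t (f y v)‖ ≤ K * ‖x - y‖ := by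
  obtain ⟨M, hM1, hM⟩ := sg_bound Tg τ
  obtain ⟨L, hL0, hL⟩ := hA1.1 (max C 1) (by positivity)
  refine ⟨M * L, by positivity, fun x y hx hy v t ht => ?_⟩
  rw [← map_sub]
  refine (hM t ht _).trans ?_
  rw [mul_assoc]
  gcongr
  exact hL x y (hx.trans (le_max_left _ _)) (hy.trans (le_max_left _ _)) v

lemma int_transfer (Tg : C0Semigroup X) {f : X → U → X} (hA1 : Assumption1 f) {z z' : ℝ → X}
    (hz : ContinuousOn z (Ici 0)) (hz' : ContinuousOn z' (Ici 0)) {u : ℝ → U} (hu : PCin u)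
    {t : ℝ} (ht : 0 ≤ t)
    (h : IntervalIntegrable (fun s => Tg.T (t - s) (f (z s) (u s))) MeasureTheory.volume 0 t) :
    IntervalIntegrable (fun s => Tg.T (t - s) (f (z' s) (u s))) MeasureTheory.volume 0 t := by
  rw [intervalIntegrable_iff_integrableOn_Icc_of_le ht] at h ⊢
  obtain ⟨C, hC⟩ := isCompact_Icc.exists_bound_of_continuousOn
    (hz.mono (Icc_subset_Ici_self : Icc 0 t ⊆ _))
  obtain ⟨C', hC'⟩ := isCompact_Icc.exists_bound_of_continuousOn
    (hz'.mono (Icc_subset_Ici_self : Icc 0 t ⊆ _))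
  obtain ⟨K, hK0, hK⟩ := diff_bound Tg hA1 t (max C C')
  have hd : MeasureTheory.IntegrableOn (fun s => Tg.T (t - s) (f (z' s) (u s))
      - Tg.T (t - s) (f (z s) (u s))) (Icc 0 t) MeasureTheory.volume := by
    refine MeasureTheory.IntegrableOn.of_bound (C := K * (C' + C)) (by simp)
      ((mild_meas Tg hA1 hz' hu).sub (mild_meas Tg hA1 hz hu)) ?_
    refine (MeasureTheory.ae_restrict_iff' measurableSet_Icc).2 (Eventually.of_forall ?_)
    intro s hs
    refine (hK _ _ ((hC' s hs).trans (le_max_right _ _)) ((hC s hs).trans (le_max_left _ _)) _ _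
      ⟨by linarith [hs.2], by linarith [hs.1]⟩).trans ?_
    gcongr
    exact (norm_sub_le _ _).trans (add_le_add (hC' s hs) (hC s hs))
  have := hd.add h
  refine this.congr (Eventually.of_forall fun s => ?_)
  simp

lemma GoodT.int {Tg : C0Semigroup X} {f : X → U → X} (hA1 : Assumption1 f) {z : ℝ → X}
    (hz : ContinuousOn z (Ici 0)) {u : ℝ → U} (hu : PCin u)
    {t : ℝ} (ht : 0 ≤ t) (h : GoodT Tg f u t) :
    IntervalIntegrable (fun s => Tg.T (t - s) (f (z s) (u s))) MeasureTheory.volume 0 t :=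
  int_transfer Tg hA1 continuousOn_const hz hu ht h

/-- Basic integral comparison of two mild trajectories. -/
lemma mild_diff {Tg : C0Semigroup X} {f : X → U → X} (hA1 : Assumption1 f) {z z' : ℝ → X}
    (hz : ContinuousOn z (Ici 0)) (hz' : ContinuousOn z' (Ici 0)) {u u' : ℝ → U} (hu : PCin u)
    (hu' : PCin u') {x : X} {p c K : ℝ} (hc : 0 ≤ c) (hK : 0 ≤ K) (hp : 0 ≤ p)
    (hg : ∀ t ∈ Icc 0 p, GoodT Tg f u t) (hg' : ∀ t ∈ Icc 0 p, GoodT Tg f u' t)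
    (h1 : ∀ t ∈ Icc 0 p, z t = Tg.T t x + ∫ s in (0:ℝ)..t, Tg.T (t - s) (f (z s) (u s)))
    (h2 : ∀ t ∈ Icc 0 p, z' t = Tg.T t x + ∫ s in (0:ℝ)..t, Tg.T (t - s) (f (z' s) (u' s)))
    (hb : ∀ t ∈ Icc 0 p, ∀ s ∈ Icc 0 p, ‖Tg.T t (f (z s) (u s)) - Tg.T t (f (z' s) (u' s))‖
      ≤ c + K * ‖z s - z' s‖) :
    ∀ t ∈ Icc 0 p, ‖z t - z' t‖ ≤ c * p * Real.exp (K * t) := by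
  have hdc : ContinuousOn (fun t => ‖z t - z' t‖) (Icc 0 p) :=
    ((hz.sub hz').norm).mono Icc_subset_Ici_self
  refine integral_gronwall hK hdc ?_
  intro t ht
  have hdi : IntervalIntegrable (fun t => ‖z t - z' t‖) MeasureTheory.volume 0 t := by
    refine ContinuousOn.intervalIntegrable (hdc.mono ?_)
    rw [uIcc_of_le ht.1]
    exact Icc_subset_Icc_right ht.2
  rw [h1 t ht, h2 t ht, add_sub_add_left_eq_sub,
    ← intervalIntegral.integral_sub ((hg t ht).int hA1 hz hu ht.1) ((hg' t ht).int hA1 hz' hu' ht.1)]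
  refine (intervalIntegral.norm_integral_le_of_norm_le (g := fun s => c + K * ‖z s - z' s‖) ht.1
    (Eventually.of_forall ?_) ?_).trans ?_
  · intro s hs
    exact hb (t - s) ⟨by linarith [hs.2], by linarith [ht.2, hs.1]⟩ s ⟨hs.1.le, hs.2.trans ht.2⟩
  · exact (intervalIntegrable_const).add (hdi.const_mul K)
  · rw [intervalIntegral.integral_add intervalIntegrable_const (hdi.const_mul K),
      intervalIntegral.integral_const_mul]
    simp only [intervalIntegral.integral_const, smul_eq_mul, sub_zero]
    have : t * c ≤ c * p := by nlinarith [ht.2]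
    linarith

lemma mild_unique {Tg : C0Semigroup X} {f : X → U → X} (hA1 : Assumption1 f) {z z' : ℝ → X}
    (hz : ContinuousOn z (Ici 0)) (hz' : ContinuousOn z' (Ici 0)) {u : ℝ → U} (hu : PCin u)
    {x : X} {p : ℝ} (hp : 0 ≤ p)
    (hg : ∀ t ∈ Icc 0 p, GoodT Tg f u t)
    (h1 : ∀ t ∈ Icc 0 p, z t = Tg.T t x + ∫ s in (0:ℝ)..t, Tg.T (t - s) (f (z s) (u s)))
    (h2 : ∀ t ∈ Icc 0 p, z' t = Tg.T t x + ∫ s in (0:ℝ)..t, Tg.T (t - s) (f (z' s) (u s))) :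
    z p = z' p := by
  obtain ⟨C, hC⟩ := isCompact_Icc.exists_bound_of_continuousOn
    (hz.mono (Icc_subset_Ici_self : Icc 0 p ⊆ _))
  obtain ⟨C', hC'⟩ := isCompact_Icc.exists_bound_of_continuousOn
    (hz'.mono (Icc_subset_Ici_self : Icc 0 p ⊆ _))
  obtain ⟨K, hK0, hK⟩ := diff_bound Tg hA1 p (max C C')
  have := mild_diff hA1 hz hz' hu hu le_rfl hK0 hp hg hg h1 h2 (fun t ht s hs => by
    rw [zero_add]
    exact hK _ _ ((hC s hs).trans (le_max_left _ _)) ((hC' s hs).trans (le_max_right _ _)) _ t ht)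
    p ⟨hp, le_rfl⟩
  rw [zero_mul, zero_mul] at this
  exact sub_eq_zero.1 (norm_le_zero_iff.1 this)

lemma GoodT.shift {Tg : C0Semigroup X} {f : X → U → X} {u : ℝ → U} {t0 t : ℝ} (h0 : 0 ≤ t0)
    (ht : 0 ≤ t) (h : GoodT Tg f u (t0 + t)) : GoodT Tg f (shiftIn t0 u) t := by
  have h1 : IntervalIntegrable (fun s => Tg.T (t0 + t - s) (f 0 (u s))) MeasureTheory.volume
      t0 (t0 + t) := by
    refine IntervalIntegrable.mono_set h ?_
    rw [uIcc_of_le (by linarith), uIcc_of_le (by linarith)]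
    exact Icc_subset_Icc_left h0
  have h2 := h1.comp_add_left t0
  simp only [sub_self, add_sub_cancel_left, add_sub_add_left_eq_sub] at h2
  exact h2

lemma GoodT.glue {Tg : C0Semigroup X} {f : X → U → X} {u : ℝ → U} {t0 t : ℝ} (h0 : 0 ≤ t0)
    (ht : 0 ≤ t) (h : GoodT Tg f u t0) (h' : GoodT Tg f (shiftIn t0 u) t) :
    GoodT Tg f u (t0 + t) := by
  have h1 : IntervalIntegrable (fun s => Tg.T (t0 + t - s) (f 0 (u s))) MeasureTheory.volume
      0 t0 := by
    rw [GoodT, intervalIntegrable_iff_integrableOn_Icc_of_le h0] at h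
    rw [intervalIntegrable_iff_integrableOn_Icc_of_le h0]
    refine ((Tg.T t).integrable_comp h).congr ?_
    refine (MeasureTheory.ae_restrict_iff' measurableSet_Icc).2 (Eventually.of_forall ?_)
    intro s hs
    have := Tg.semigroup' t ht (t0 - s) (by linarith [hs.2])
    rw [show t + (t0 - s) = t0 + t - s by ring] at this
    simp [this]
  have h2 := h'.comp_sub_right t0
  simp only [shiftIn, zero_add] at h2
  refine h1.trans ?_
  rw [add_comm t t0] at h2
  refine h2.congr ?_
  intro s _
  simp only []
  rw [show t - (s - t0) = t0 + t - s by ring, show t0 + (s - t0) = s by ring]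

lemma flow_zero {Tg : C0Semigroup X} {f : X → U → X} {φ : ℝ → X → (ℝ → U) → X}
    (hφ : IsMildFlow Tg f φ) (x : X) {u : ℝ → U} (hu : PCin u) : φ 0 x u = x := by
  have := (hφ x u hu).1 0 le_rfl
  simpa [Tg.map_zero'] using this

lemma cocycle_of_good {Tg : C0Semigroup X} {f : X → U → X} (hA1 : Assumption1 f)
    {φ : ℝ → X → (ℝ → U) → X} (hφ : IsMildFlow Tg f φ) (x : X) {u : ℝ → U} (hu : PCin u)
    {t0 t : ℝ} (h0 : 0 ≤ t0) (ht : 0 ≤ t) (hg : ∀ s ∈ Icc 0 (t0 + t), GoodT Tg f u s) :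
    φ (t0 + t) x u = φ t (φ t0 x u) (shiftIn t0 u) := by
  obtain ⟨h1, h2⟩ := hφ x u hu
  obtain ⟨h3, h4⟩ := hφ (φ t0 x u) (shiftIn t0 u) (hu.shift h0)
  have hz : ContinuousOn (fun r => φ (t0 + r) x u) (Ici 0) := by
    refine h2.comp (t := Ici 0) (by fun_prop) ?_
    intro r hr
    simp only [mem_Ici] at hr ⊢; linarith
  refine mild_unique (z := fun r => φ (t0 + r) x u) (x := φ t0 x u) hA1 hz h4 (hu.shift h0) ht
    (fun s hs => GoodT.shift h0 hs.1 (hg _ ⟨by linarith [hs.1], by linarith [hs.2]⟩)) ?_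
    (fun s hs => h3 s hs.1)
  intro r hr
  have hr0 := hr.1
  have hi : IntervalIntegrable (fun s => Tg.T (t0 + r - s) (f (φ s x u) (u s)))
      MeasureTheory.volume 0 (t0 + r) :=
    (hg (t0 + r) ⟨by linarith, by linarith [hr.2]⟩).int hA1 h2 hu (by linarith)
  have hi0 : IntervalIntegrable (fun s => Tg.T (t0 - s) (f (φ s x u) (u s)))
      MeasureTheory.volume 0 t0 :=
    (hg t0 ⟨by linarith, by linarith [hr.2]⟩).int hA1 h2 hu (by linarith)
  rw [h1 (t0 + r) (by linarith)]
  have hsplit := intervalIntegral.integral_add_adjacent_intervals (a := 0) (b := t0) (c := t0 + r)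
    (hi.mono_set (by
      rw [uIcc_of_le h0, uIcc_of_le (by linarith)]; exact Icc_subset_Icc_right (by linarith)))
    (hi.mono_set (by
      rw [uIcc_of_le (by linarith), uIcc_of_le (by linarith)]; exact Icc_subset_Icc_left h0))
  rw [← hsplit]
  have e1 : ∫ s in (0:ℝ)..t0, Tg.T (t0 + r - s) (f (φ s x u) (u s))
      = Tg.T r (∫ s in (0:ℝ)..t0, Tg.T (t0 - s) (f (φ s x u) (u s))) := by
    rw [← (Tg.T r).intervalIntegral_comp_comm hi0]
    refine intervalIntegral.integral_congr fun s hs => ?_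
    rw [uIcc_of_le h0] at hs
    have := Tg.semigroup' r hr0 (t0 - s) (by linarith [hs.2])
    rw [show r + (t0 - s) = t0 + r - s by ring] at this
    simp [this]
  have e2 : ∫ s in t0..(t0 + r), Tg.T (t0 + r - s) (f (φ s x u) (u s))
      = ∫ s in (0:ℝ)..r, Tg.T (r - s) (f (φ (t0 + s) x u) (shiftIn t0 u s)) := by
    have := intervalIntegral.integral_comp_add_left (a := 0) (b := r)
      (fun s => Tg.T (t0 + r - s) (f (φ s x u) (u s))) t0
    rw [add_zero] at this
    rw [← this]
    refine intervalIntegral.integral_congr fun s hs => ?_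
    simp only [shiftIn, add_sub_add_left_eq_sub]
  have e3 : Tg.T (t0 + r) x = Tg.T r (Tg.T t0 x) := by
    rw [add_comm, Tg.semigroup' r hr0 t0 h0]; rfl
  rw [e1, e2, e3]
  conv_rhs => rw [h1 t0 h0]
  rw [map_add, add_assoc]

lemma flow_of_bad {Tg : C0Semigroup X} {f : X → U → X} (hA1 : Assumption1 f)
    {φ : ℝ → X → (ℝ → U) → X} (hφ : IsMildFlow Tg f φ) (x : X) {u : ℝ → U} (hu : PCin u)
    {t : ℝ} (ht : 0 ≤ t) (hb : ¬ GoodT Tg f u t) : φ t x u = Tg.T t x := by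
  obtain ⟨h1, h2⟩ := hφ x u hu
  rw [h1 t ht, intervalIntegral.integral_undef, add_zero]
  intro h
  exact hb (int_transfer Tg hA1 h2 continuousOn_const hu ht h)

lemma flow_deriv_zero {Tg : C0Semigroup X} {f : X → U → X} (hA1 : Assumption1 f)
    {φ : ℝ → X → (ℝ → U) → X} (hφ : IsMildFlow Tg f φ) {u : ℝ → U} (hu : PCin u)
    {p : ℝ} (hp : 0 < p) (hg : ∀ s ∈ Ico 0 p, GoodT Tg f u s) {η : ℝ} (hη : 0 < η) :
    ∃ ε, 0 < ε ∧ ε < p ∧ ‖φ ε 0 u - ε • f 0 (u 0)‖ ≤ η * ε := by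
  obtain ⟨h1, h2⟩ := hφ 0 u hu
  have ht : Tendsto (fun q : ℝ × ℝ => Tg.T q.1 (f (φ q.2 0 u) (u q.2)))
      (nhdsWithin 0 (Ici 0) ×ˢ nhdsWithin 0 (Ici 0)) (nhds (Tg.T 0 (f 0 (u 0)))) := by
    refine sg_tendsto Tg le_rfl tendsto_fst (f_tendsto hA1 ?_ ?_)
    · have : Tendsto (fun t => φ t 0 u) (nhdsWithin 0 (Ici 0)) (nhds (φ 0 0 u)) :=
        h2 0 (mem_Ici.2 le_rfl)
      rw [flow_zero hφ 0 hu] at this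
      exact this.comp tendsto_snd
    · have : Tendsto u (nhdsWithin 0 (Ici 0)) (nhds (u 0)) := hu.2.1 0 le_rfl
      exact this.comp tendsto_snd
  rw [Tg.map_zero'] at ht
  have ht2 := ht.eventually (Metric.ball_mem_nhds _ hη)
  obtain ⟨s, hs, hs2⟩ := Filter.eventually_prod_self_iff (r := fun a b => dist (Tg.T a (f (φ b 0 u) (u b))) ((ContinuousLinearMap.id ℝ X) (f 0 (u 0))) < η) |>.1 ht2
  obtain ⟨e, he, hes⟩ := Metric.mem_nhdsWithin_iff.1 hs
  set ε := min (e / 2) (p / 2) with hε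
  have hε0 : 0 < ε := by positivity
  have hεe : ε < e := (min_le_left _ _).trans_lt (by linarith)
  have hεp : ε < p := (min_le_right _ _).trans_lt (by linarith)
  refine ⟨ε, hε0, hεp, ?_⟩
  have mem : ∀ r, 0 ≤ r → r ≤ ε → r ∈ s := by
    intro r hr0 hr
    refine hes ⟨?_, hr0⟩
    rw [Metric.mem_ball, Real.dist_eq, sub_zero, abs_of_nonneg hr0]; linarith
  rw [h1 ε hε0.le, map_zero, zero_add]
  have hc : ε • f 0 (u 0) = ∫ s in (0:ℝ)..ε, f 0 (u 0) := by simp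
  rw [hc, ← intervalIntegral.integral_sub ((hg ε ⟨hε0.le, hεp⟩).int hA1 h2 hu hε0.le)
    intervalIntegrable_const]
  refine (intervalIntegral.norm_integral_le_of_norm_le_const (C := η) ?_).trans ?_
  · intro r hr
    rw [uIoc_of_le hε0.le] at hr
    have := hs2 (ε - r) (mem _ (by linarith [hr.2]) (by linarith [hr.1])) r (mem _ hr.1.le hr.2)
    simp only [ContinuousLinearMap.id_apply, Metric.mem_ball, dist_eq_norm] at this
    exact this.le
  · rw [sub_zero, abs_of_nonneg hε0.le]

lemma good_closed {Tg : C0Semigroup X} {f : X → U → X} (hA1 : Assumption1 f)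
    {φ : ℝ → X → (ℝ → U) → X} (hφ : IsMildFlow Tg f φ) {u : ℝ → U} (hu : PCin u)
    {p : ℝ} (hp : 0 < p) (hg : ∀ s ∈ Ico 0 p, GoodT Tg f u s) : GoodT Tg f u p := by
  by_contra hbad
  have hshift : ∀ δ ∈ Ico 0 p, ∀ s ∈ Ico 0 (p - δ), GoodT Tg f (shiftIn δ u) s := by
    intro δ hδ s hs
    exact GoodT.shift hδ.1 hs.1 (hg _ ⟨by linarith [hδ.1, hs.1], by linarith [hs.2]⟩)
  have hsbad : ∀ δ ∈ Ico 0 p, ¬ GoodT Tg f (shiftIn δ u) (p - δ) := by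
    intro δ hδ h
    have := GoodT.glue hδ.1 (by linarith [hδ.2]) (hg δ hδ) h
    rw [add_sub_cancel] at this
    exact hbad this
  have key : ∀ δ ∈ Ico 0 p, ∀ ε ∈ Ioo 0 (p - δ), Tg.T (p - δ) (φ ε 0 (shiftIn δ u)) = 0 := by
    intro δ hδ ε hε
    have huδ := hu.shift hδ.1
    have hδε : δ + ε ∈ Ico 0 p := ⟨by linarith [hδ.1, hε.1], by linarith [hε.2]⟩
    have huε := huδ.shift hε.1.le
    have hb1 : φ (p - δ) 0 (shiftIn δ u) = 0 := by
      rw [flow_of_bad hA1 hφ 0 huδ (by linarith [hδ.2]) (hsbad δ hδ), map_zero]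
    have hb2 : φ (p - δ - ε) (φ ε 0 (shiftIn δ u)) (shiftIn ε (shiftIn δ u))
        = Tg.T (p - δ - ε) (φ ε 0 (shiftIn δ u)) := by
      refine flow_of_bad hA1 hφ _ huε (by linarith [hε.2]) ?_
      rw [shiftIn_shiftIn, show p - δ - ε = p - (δ + ε) by ring]
      exact hsbad _ hδε
    -- continuity
    have hpos : 0 < p - δ - ε := by linarith [hε.2]
    have c1 : ContinuousWithinAt (fun t => φ (ε + t) 0 (shiftIn δ u)) (Iio (p - δ - ε) ∩ Ici 0)
        (p - δ - ε) := by
      have : ContinuousOn (fun t => φ (ε + t) 0 (shiftIn δ u)) (Ici 0) := by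
        refine (hφ 0 _ huδ).2.comp (t := Ici 0) (by fun_prop) ?_
        intro r hr
        have := hε.1
        simp only [mem_Ici] at hr ⊢; linarith
      exact (this _ (mem_Ici.2 hpos.le)).mono inter_subset_right
    have c2 : ContinuousWithinAt (fun t => φ t (φ ε 0 (shiftIn δ u)) (shiftIn ε (shiftIn δ u)))
        (Iio (p - δ - ε) ∩ Ici 0) (p - δ - ε) :=
      ((hφ _ _ huε).2 _ (mem_Ici.2 hpos.le)).mono inter_subset_right
    have heq : ∀ t ∈ Iio (p - δ - ε) ∩ Ici 0, φ (ε + t) 0 (shiftIn δ u)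
        = φ t (φ ε 0 (shiftIn δ u)) (shiftIn ε (shiftIn δ u)) := by
      intro t ht
      have ht1 : t < p - δ - ε := ht.1
      have ht2 : 0 ≤ t := ht.2
      refine cocycle_of_good hA1 hφ 0 huδ hε.1.le ht2 fun s hs => ?_
      exact hshift δ hδ s ⟨hs.1, by linarith [hs.2]⟩
    have hne : (nhdsWithin (p - δ - ε) (Iio (p - δ - ε) ∩ Ici 0)).NeBot := by
      have : nhdsWithin (p - δ - ε) (Iio (p - δ - ε) ∩ Ici 0)
          = nhdsWithin (p - δ - ε) (Iio (p - δ - ε)) :=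
        nhdsWithin_inter_of_mem' (mem_nhdsWithin_of_mem_nhds (Ici_mem_nhds hpos))
      rw [this]; infer_instance
    have hlim := tendsto_nhds_unique_of_eventuallyEq c1 c2
      (by filter_upwards [self_mem_nhdsWithin] with t ht using heq t ht)
    simp only at hlim
    rw [add_sub_cancel, hb1, hb2] at hlim
    have := Tg.semigroup' ε hε.1.le (p - δ - ε) hpos.le
    rw [add_sub_cancel] at this
    rw [this, ContinuousLinearMap.comp_apply, ← hlim, map_zero]
  have zero : ∀ δ ∈ Ico 0 p, Tg.T (p - δ) (f 0 (u δ)) = 0 := by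
    intro δ hδ
    obtain ⟨M, hM1, hM⟩ := sg_bound Tg (p - δ)
    have hpd : 0 < p - δ := by linarith [hδ.2]
    rw [← norm_le_zero_iff]
    refine le_of_forall_pos_le_add fun η hη => ?_
    rw [zero_add]
    obtain ⟨ε, hε0, hεp, h⟩ := flow_deriv_zero hA1 hφ (hu.shift hδ.1) hpd (hshift δ hδ)
      (η := η / M) (by positivity)
    have h1 := key δ hδ ε ⟨hε0, hεp⟩
    have h2 := hM (p - δ) ⟨hpd.le, le_rfl⟩ (φ ε 0 (shiftIn δ u) - ε • f 0 (shiftIn δ u 0))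
    rw [map_sub, h1, zero_sub, norm_neg, map_smul, norm_smul, Real.norm_eq_abs,
      abs_of_pos hε0] at h2
    simp only [shiftIn, add_zero] at h2 h
    have h3 : ε * ‖Tg.T (p - δ) (f 0 (u δ))‖ ≤ ε * η := by
      refine h2.trans ((mul_le_mul_of_nonneg_left h (by positivity)).trans ?_)
      have : M * (η / M * ε) = ε * η := by field_simp
      rw [this]
    exact le_of_mul_le_mul_left h3 hε0
  apply hbad
  rw [GoodT, intervalIntegrable_iff_integrableOn_Ico_of_le hp.le]
  refine MeasureTheory.integrableOn_zero.congr_fun (fun s hs => ?_) measurableSet_Ico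
  exact (zero s hs).symm

lemma good_right {Tg : C0Semigroup X} {f : X → U → X} (hA1 : Assumption1 f)
    {u : ℝ → U} (hu : PCin u) : ∃ η, 0 < η ∧ ∀ t ∈ Icc 0 η, GoodT Tg f u t := by
  have h1 : Tendsto (fun s => f 0 (u s)) (nhdsWithin 0 (Ici 0)) (nhds (f 0 (u 0))) :=
    f_tendsto hA1 tendsto_const_nhds (hu.2.1 0 le_rfl)
  have h2 := h1.norm.eventually (gt_mem_nhds (lt_add_one _))
  obtain ⟨e, he, hes⟩ := Metric.mem_nhdsWithin_iff.1 h2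
  refine ⟨e / 2, by positivity, fun t ht => ?_⟩
  obtain ⟨M, hM1, hM⟩ := sg_bound Tg t
  rw [GoodT, intervalIntegrable_iff_integrableOn_Icc_of_le ht.1]
  refine MeasureTheory.IntegrableOn.of_bound (C := M * (‖f 0 (u 0)‖ + 1)) (by simp)
    (mild_meas Tg hA1 (z := fun _ => 0) continuousOn_const hu) ?_
  refine (MeasureTheory.ae_restrict_iff' measurableSet_Icc).2 (Eventually.of_forall ?_)
  intro s hs
  refine (hM _ ⟨by linarith [hs.2], by linarith [hs.1]⟩ _).trans ?_
  gcongr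
  refine le_of_lt (hes ⟨?_, hs.1⟩)
  rw [Metric.mem_ball, Real.dist_eq, sub_zero, abs_of_nonneg hs.1]; linarith [hs.2, ht.2]

lemma good_all {Tg : C0Semigroup X} {f : X → U → X} (hA1 : Assumption1 f)
    {φ : ℝ → X → (ℝ → U) → X} (hφ : IsMildFlow Tg f φ) {u : ℝ → U} (hu : PCin u)
    {t : ℝ} (ht : 0 ≤ t) : GoodT Tg f u t := by
  by_contra hbad
  set B : Set ℝ := {s | 0 ≤ s ∧ ¬ GoodT Tg f u s} with hB
  have hne : B.Nonempty := ⟨t, ht, hbad⟩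
  have hbb : BddBelow B := ⟨0, fun s hs => hs.1⟩
  set b := sInf B with hb
  have hb0 : 0 ≤ b := le_csInf hne fun s hs => hs.1
  have hlow : ∀ s ∈ Ico 0 b, GoodT Tg f u s := by
    intro s hs
    by_contra h
    exact absurd (csInf_le hbb (show s ∈ B from ⟨hs.1, h⟩)) (not_le.2 hs.2)
  have hgb : GoodT Tg f u b := by
    rcases hb0.eq_or_lt with h | h
    · rw [← h, GoodT]
    · exact good_closed hA1 hφ hu h hlow
  obtain ⟨η, hη, hr⟩ := good_right (Tg := Tg) hA1 (hu.shift hb0)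
  obtain ⟨s, hs, hsb⟩ := exists_lt_of_csInf_lt hne (show sInf B < b + η by linarith)
  have hbs : b ≤ s := csInf_le hbb hs
  have := GoodT.glue hb0 (t := s - b) (by linarith) hgb (hr _ ⟨by linarith, by linarith⟩)
  rw [add_sub_cancel] at this
  exact hs.2 this

lemma cocycle {Tg : C0Semigroup X} {f : X → U → X} (hA1 : Assumption1 f)
    {φ : ℝ → X → (ℝ → U) → X} (hφ : IsMildFlow Tg f φ) (x : X) {u : ℝ → U} (hu : PCin u)
    {t0 t : ℝ} (h0 : 0 ≤ t0) (ht : 0 ≤ t) :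
    φ (t0 + t) x u = φ t (φ t0 x u) (shiftIn t0 u) :=
  cocycle_of_good hA1 hφ x hu h0 ht fun s hs => good_all hA1 hφ hu hs.1

/-- continuity at the equilibrium for the undisturbed system -/
lemma zero_cep {Tg : C0Semigroup X} {f : X → U → X} (hA1 : Assumption1 f)
    {φ : ℝ → X → (ℝ → U) → X} (hφ : IsMildFlow Tg f φ) (hBRS : pBRS φ) {ε h : ℝ} (hε : 0 < ε)
    (hh : 0 < h) : ∃ δ, 0 < δ ∧ ∀ x : X, ‖x‖ ≤ δ → ∀ t ∈ Icc 0 h, ‖φ t x (fun _ => 0)‖ ≤ ε := by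
  obtain ⟨C, hC⟩ := hBRS 1 one_pos h hh
  obtain ⟨M, hM1, hM⟩ := sg_bound Tg h
  obtain ⟨K, hK0, hK⟩ := diff_bound Tg hA1 h (max C 0)
  refine ⟨min 1 (ε / (M * Real.exp (K * h))), by positivity, fun x hx t ht => ?_⟩
  have hx1 : ‖x‖ ≤ 1 := hx.trans (min_le_left _ _)
  have hx2 : ‖x‖ ≤ ε / (M * Real.exp (K * h)) := hx.trans (min_le_right _ _)
  obtain ⟨h1, h2⟩ := hφ x _ (PCin_zero (U := U))
  have hdc : ContinuousOn (fun t => ‖φ t x (fun _ => 0)‖) (Icc 0 h) :=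
    h2.norm.mono Icc_subset_Ici_self
  have hgr := integral_gronwall (c := M * ‖x‖) hK0 hdc (fun t ht => by
    have hdi : IntervalIntegrable (fun t => ‖φ t x (fun _ => 0)‖) MeasureTheory.volume 0 t := by
      refine ContinuousOn.intervalIntegrable (hdc.mono ?_)
      rw [uIcc_of_le ht.1]
      exact Icc_subset_Icc_right ht.2
    rw [h1 t ht.1]
    refine (norm_add_le _ _).trans (add_le_add (hM t ht x) ?_)
    rw [← intervalIntegral.integral_const_mul]
    refine intervalIntegral.norm_integral_le_of_norm_le ht.1 (Eventually.of_forall ?_)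
      (hdi.const_mul K)
    intro s hs
    have hb := hC x hx1 _ (PCin_zero (U := U)) (by rw [pcNorm_zero]; norm_num) s
      ⟨hs.1.le, hs.2.trans ht.2⟩
    have := hK (φ s x fun _ => 0) 0 (hb.trans (le_max_left _ _)) (by simp) 0 (t - s)
      ⟨by linarith [hs.2], by linarith [hs.1, ht.2]⟩
    rw [hA1.2.2, map_zero, sub_zero, sub_zero] at this
    exact this) t ht
  refine hgr.trans ?_
  have hexp : Real.exp (K * t) ≤ Real.exp (K * h) := by gcongr; exact ht.2
  calc M * ‖x‖ * Real.exp (K * t)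
      ≤ M * (ε / (M * Real.exp (K * h))) * Real.exp (K * h) := by gcongr
    _ = ε := by field_simp

/-- continuity with respect to small inputs near the equilibrium -/
lemma input_cont {Tg : C0Semigroup X} {f : X → U → X} (hA1 : Assumption1 f)
    (hd : PropertyDiamond f)
    {φ : ℝ → X → (ℝ → U) → X} (hφ : IsMildFlow Tg f φ) (hBRS : pBRS φ) :
    ∃ r, 0 < r ∧ ∀ ε, 0 < ε → ∀ h, 0 < h → ∃ δ, 0 < δ ∧ ∀ x : X, ‖x‖ ≤ r →
      (∀ t, 0 ≤ t → ‖φ t x (fun _ => 0)‖ ≤ r) → ∀ u : ℝ → U, PCin u → pcNorm u ≤ δ →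
        ∀ t ∈ Icc 0 h, ‖φ t x u - φ t x (fun _ => 0)‖ ≤ ε := by
  obtain ⟨σ, hσ, r, hr, hdd⟩ := hd
  refine ⟨r, hr, fun ε hε h hh => ?_⟩
  obtain ⟨C, hC⟩ := hBRS r hr h hh
  obtain ⟨M, hM1, hM⟩ := sg_bound Tg h
  obtain ⟨K, hK0, hK⟩ := diff_bound Tg hA1 h C
  obtain ⟨δ, hδ, hσδ⟩ := hσ.small (ε := ε / (M * h * Real.exp (K * h))) (by positivity)
  refine ⟨min δ (r / 2), by positivity, fun x hx hx0 u hu hun t ht => ?_⟩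
  have hu1 : pcNorm u ≤ δ := hun.trans (min_le_left _ _)
  have hu2 : pcNorm u ≤ r / 2 := hun.trans (min_le_right _ _)
  obtain ⟨h1, h2⟩ := hφ x u hu
  obtain ⟨h3, h4⟩ := hφ x _ (PCin_zero (U := U))
  have hc0 := hσ.nonneg (pcNorm_nonneg u)
  have := mild_diff hA1 h2 h4 hu PCin_zero (c := M * σ (pcNorm u)) (by positivity) hK0 hh.le
    (fun t ht => good_all hA1 hφ hu ht.1) (fun t ht => good_all hA1 hφ PCin_zero ht.1)
    (fun t ht => h1 t ht.1) (fun t ht => h3 t ht.1) (fun t ht s hs => by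
      have k1 := hK (φ s x u) (φ s x fun _ => 0) (hC x hx u hu (by linarith) s hs)
        (hC x hx _ PCin_zero (by rw [pcNorm_zero]; exact hr.le) s hs) (u s) t ht
      have k2 := hdd (u s) (by linarith [hu.le_norm hs.1]) _ (hx0 s hs.1)
      have k3 := hM t ht (f (φ s x fun _ => 0) (u s) - f (φ s x fun _ => 0) 0)
      rw [map_sub] at k3
      have k4 : σ ‖u s‖ ≤ σ (pcNorm u) := hσ.mono (norm_nonneg _) (hu.le_norm hs.1)
      have k5 : M * ‖f (φ s x fun _ => 0) (u s) - f (φ s x fun _ => 0) 0‖ ≤ M * σ (pcNorm u) := by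
        gcongr; exact k2.trans k4
      have k6 := norm_sub_le_norm_sub_add_norm_sub (Tg.T t (f (φ s x u) (u s)))
        (Tg.T t (f (φ s x fun _ => 0) (u s))) (Tg.T t (f (φ s x fun _ => 0) 0))
      linarith) t ht
  refine this.trans ?_
  have hexp : Real.exp (K * t) ≤ Real.exp (K * h) := by gcongr; exact ht.2
  have hs := hσδ _ (pcNorm_nonneg u) hu1
  calc M * σ (pcNorm u) * h * Real.exp (K * t)
      ≤ M * (ε / (M * h * Real.exp (K * h))) * h * Real.exp (K * h) := by gcongr
    _ = ε := by field_simp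

/-- Basic properties of a forward complete control system. -/
structure Sys (φ : ℝ → X → (ℝ → U) → X) : Prop where
  cont : ∀ (x : X) (u : ℝ → U), PCin u → ContinuousOn (fun t => φ t x u) (Ici 0)
  zero : ∀ (x : X) (u : ℝ → U), PCin u → φ 0 x u = x
  coc : ∀ (x : X) (u : ℝ → U), PCin u → ∀ a b : ℝ, 0 ≤ a → 0 ≤ b →
    φ (a + b) x u = φ b (φ a x u) (shiftIn a u)

/-- Decrease of `V` in dissipation form. -/
def Decr (φ : ℝ → X → (ℝ → U) → X) (V : X → ℝ) (α σ : ℝ → ℝ) : Prop :=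
  ∀ (x : X) (u : ℝ → U), PCin u → ∀ a b c : ℝ, 0 ≤ a → a ≤ b →
    (∀ s ∈ Ico a b, -α ‖φ s x u‖ + σ (pcNorm u) ≤ -c) → V (φ b x u) ≤ V (φ a x u) - c * (b - a)

lemma decr_of_dini {φ : ℝ → X → (ℝ → U) → X} (hS : Sys φ) {V : X → ℝ} {α σ : ℝ → ℝ}
    (hV : Continuous V) (hσ : ClassK σ)
    (hD : ∀ x : X, ∀ u : ℝ → U, PCin u →
      pDiniLimsup φ V x u ≤ ((-α ‖x‖ + σ (pcNorm u) : ℝ) : EReal)) : Decr φ V α σ := by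
  intro x u hu a b c ha hab h
  have hcont : ContinuousOn (fun t => V (φ t x u)) (Icc a b) :=
    hV.comp_continuousOn ((hS.cont x u hu).mono fun t ht => mem_Ici.2 (ha.trans ht.1))
  refine image_le_of_liminf_slope_right_le_deriv_boundary (B := fun t => V (φ a x u) - c * (t - a))
    (B' := fun _ => -c) hcont (by simp) (by fun_prop) ?_ ?_ (right_mem_Icc.2 hab)
  · intro s hs
    have := (((hasDerivAt_id s).sub_const a).const_mul c).const_sub (V (φ a x u))
    simpa using this.hasDerivWithinAt
  · intro s hs r hr
    have hs0 : 0 ≤ s := ha.trans hs.1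
    have h1 := hD (φ s x u) (shiftIn s u) (hu.shift hs0)
    have h2 : -α ‖φ s x u‖ + σ (pcNorm (shiftIn s u)) ≤ -c := by
      have := hσ.mono (pcNorm_nonneg _) (hu.shift_norm hs0)
      linarith [h s hs]
    have h3 : pDiniLimsup φ V (φ s x u) (shiftIn s u) < (r : EReal) :=
      h1.trans_lt (EReal.coe_lt_coe_iff.2 (h2.trans_lt hr))
    have h4 := eventually_lt_of_limsup_lt h3
    have hm : Tendsto (fun z => z - s) (nhdsWithin s (Ioi s)) (nhdsWithin 0 (Ioi 0)) := by
      refine tendsto_nhdsWithin_iff.2 ⟨?_, ?_⟩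
      · have : Tendsto (fun z : ℝ => z - s) (nhds s) (nhds (s - s)) :=
          (continuous_id.sub continuous_const).tendsto s
        rw [sub_self] at this
        exact this.mono_left nhdsWithin_le_nhds
      · filter_upwards [self_mem_nhdsWithin] with z hz
        have : s < z := hz
        exact mem_Ioi.2 (by linarith)
    have h5 := hm.eventually h4
    refine Eventually.frequently ?_
    filter_upwards [h5, self_mem_nhdsWithin] with z hz1 hz2
    have hz3 : s < z := hz2
    have hz4 := EReal.coe_lt_coe_iff.1 hz1
    rw [← hS.coc x u hu s (z - s) hs0 (by linarith), add_sub_cancel] at hz4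
    rw [slope_def_field]
    exact hz4

section
variable {φ : ℝ → X → (ℝ → U) → X} {V : X → ℝ} {ψ α σ : ℝ → ℝ}

lemma lim_lemma (hS : Sys φ) (hD : Decr φ V α σ) (hV0 : ∀ x, 0 ≤ V x) (hψ : ClassK ψ)
    (hVψ : ∀ x, V x ≤ ψ ‖x‖) {R δ : ℝ} (hR : 0 ≤ R) (hδ : 0 < δ) :
    ∃ τ, 0 < τ ∧ ∀ x : X, ‖x‖ ≤ R → ∀ u : ℝ → U, PCin u →
      ∃ t ∈ Icc 0 τ, α ‖φ t x u‖ ≤ σ (pcNorm u) + δ := by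
  have hψR := hψ.nonneg hR
  refine ⟨(ψ R + 1) / δ, by positivity, fun x hx u hu => ?_⟩
  by_contra! hcon
  have := hD x u hu 0 ((ψ R + 1) / δ) δ le_rfl (by positivity) (fun s hs => by
    have := hcon s ⟨hs.1, hs.2.le⟩
    linarith)
  rw [hS.zero x u hu, sub_zero, mul_div_cancel₀ _ hδ.ne'] at this
  have h1 := hV0 (φ ((ψ R + 1) / δ) x u)
  have h2 := hVψ x
  have h3 := hψ.mono (norm_nonneg x) hx
  linarith

lemma shift_zero_input (s : ℝ) : shiftIn s (fun _ => (0 : U)) = fun _ => 0 := rfl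

lemma zero_stab (hS : Sys φ) (hD : Decr φ V α σ) (hV0 : ∀ x, 0 ≤ V x) (hψ : ClassK ψ)
    (hα : ClassK α) (hσ : ClassK σ) (hVψ : ∀ x, V x ≤ ψ ‖x‖)
    (hcep : ∀ ε, 0 < ε → ∃ δ, 0 < δ ∧ ∀ x : X, ‖x‖ ≤ δ → ∀ t ∈ Icc (0:ℝ) 1,
      ‖φ t x (fun _ => 0)‖ ≤ ε) {ε : ℝ} (hε : 0 < ε) :
    ∃ η, 0 < η ∧ ∀ x : X, ‖x‖ ≤ η → ∀ t, 0 ≤ t → ‖φ t x (fun _ => 0)‖ ≤ ε := by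
  obtain ⟨δ, hδ, hδ2⟩ := hcep ε hε
  obtain ⟨η, hη, hη2⟩ := hψ.small (ε := α δ / 2) (by have := hα.pos hδ; positivity)
  refine ⟨min δ η, by positivity, fun x hx t ht => ?_⟩
  have hx1 : ‖x‖ ≤ δ := hx.trans (min_le_left _ _)
  have hx2 : ‖x‖ ≤ η := hx.trans (min_le_right _ _)
  by_contra! hcon
  have ht1 : 1 < t := by
    by_contra! h
    exact absurd (hδ2 x hx1 t ⟨ht, h⟩) (not_le.2 hcon)
  have hz : PCin (fun _ : ℝ => (0 : U)) := PCin_zero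
  have hbig : ∀ s ∈ Ico (t - 1) t, -α ‖φ s x (fun _ => 0)‖ + σ (pcNorm (fun _ : ℝ => (0 : U)))
      ≤ -(α δ) := by
    intro s hs
    have hs1 := hs.1
    have hs2 := hs.2
    rw [pcNorm_zero, hσ.2.2, add_zero, neg_le_neg_iff]
    refine hα.mono hδ.le ?_
    by_contra! h
    have := hδ2 _ h.le (t - s) ⟨by linarith, by linarith⟩
    have hc := hS.coc x _ hz s (t - s) (by linarith) (by linarith)
    rw [shift_zero_input, add_sub_cancel] at hc
    rw [← hc] at this
    exact absurd this (not_le.2 hcon)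
  have d1 := hD x _ hz (t - 1) t (α δ) (by linarith) (by linarith) hbig
  have d2 := hD x _ hz 0 (t - 1) 0 le_rfl (by linarith) (fun s hs => by
    rw [pcNorm_zero, hσ.2.2]
    have := hα.nonneg (norm_nonneg (φ s x (fun _ => 0)))
    linarith)
  rw [hS.zero x _ hz] at d2
  have h1 := hV0 (φ t x (fun _ => 0))
  have h2 := hVψ x
  have h3 := hη2 _ (norm_nonneg x) hx2
  have h4 := hα.pos hδ
  linarith

lemma return_lemma (hS : Sys φ) {ρ b M τ : ℝ}
    (hret : ∀ x : X, ‖x‖ ≤ ρ → ∀ u : ℝ → U, PCin u → pcNorm u ≤ b →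
      ∃ T, 1 ≤ T ∧ T ≤ τ ∧ ‖φ T x u‖ ≤ ρ)
    (hM : ∀ x : X, ‖x‖ ≤ ρ → ∀ u : ℝ → U, PCin u → pcNorm u ≤ b → ∀ t ∈ Icc 0 τ, ‖φ t x u‖ ≤ M) :
    ∀ x : X, ‖x‖ ≤ ρ → ∀ u : ℝ → U, PCin u → pcNorm u ≤ b → ∀ t, 0 ≤ t → ‖φ t x u‖ ≤ M := by
  have key : ∀ n : ℕ, ∀ x : X, ‖x‖ ≤ ρ → ∀ u : ℝ → U, PCin u → pcNorm u ≤ b →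
      ∀ t : ℝ, 0 ≤ t → t ≤ n → ‖φ t x u‖ ≤ M := by
    intro n
    induction n with
    | zero =>
      intro x hx u hu hub t ht htn
      obtain ⟨T, h1, h2, h3⟩ := hret x hx u hu hub
      push_cast at htn
      exact hM x hx u hu hub t ⟨ht, by linarith⟩
    | succ n ih =>
      intro x hx u hu hub t ht htn
      push_cast at htn
      obtain ⟨T, h1, h2, h3⟩ := hret x hx u hu hub
      rcases le_total t T with h | h
      · exact hM x hx u hu hub t ⟨ht, h.trans h2⟩
      · have hT0 : 0 ≤ T := by linarith
        have := hS.coc x u hu T (t - T) hT0 (by linarith)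
        rw [add_sub_cancel] at this
        rw [this]
        exact ih _ h3 _ (hu.shift hT0) ((hu.shift_norm hT0).trans hub) _ (by linarith) (by linarith)
  intro x hx u hu hub t ht
  obtain ⟨n, hn⟩ := exists_nat_ge t
  exact key n x hx u hu hub t ht hn

lemma local_stab (hS : Sys φ) (hD : Decr φ V α σ) (hV0 : ∀ x, 0 ≤ V x) (hψ : ClassK ψ)
    (hα : ClassK α) (hσ : ClassK σ) (hVψ : ∀ x, V x ≤ ψ ‖x‖)
    (hcep : ∀ ε, 0 < ε → ∃ δ, 0 < δ ∧ ∀ x : X, ‖x‖ ≤ δ → ∀ t ∈ Icc (0:ℝ) 1,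
      ‖φ t x (fun _ => 0)‖ ≤ ε)
    (hic : ∃ r, 0 < r ∧ ∀ ε, 0 < ε → ∀ h, 0 < h → ∃ δ, 0 < δ ∧ ∀ x : X, ‖x‖ ≤ r →
      (∀ t, 0 ≤ t → ‖φ t x (fun _ => 0)‖ ≤ r) → ∀ u : ℝ → U, PCin u → pcNorm u ≤ δ →
        ∀ t ∈ Icc 0 h, ‖φ t x u - φ t x (fun _ => 0)‖ ≤ ε) {ε : ℝ} (hε : 0 < ε) :
    ∃ δ, 0 < δ ∧ ∀ x : X, ‖x‖ ≤ δ → ∀ u : ℝ → U, PCin u → pcNorm u ≤ δ → ∀ t, 0 ≤ t →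
      ‖φ t x u‖ ≤ ε := by
  obtain ⟨r, hr, hic⟩ := hic
  have hz : PCin (fun _ : ℝ => (0 : U)) := PCin_zero
  have hzs := fun {ε : ℝ} => zero_stab (ε := ε) hS hD hV0 hψ hα hσ hVψ hcep
  obtain ⟨η₀, hη₀, hη⟩ := hzs (ε := min ε r / 2) (by positivity)
  set η := min η₀ r with hηd
  have hηp : 0 < η := by positivity
  obtain ⟨η', hη', hη2⟩ := hzs (ε := η / 2) (by positivity)
  obtain ⟨τ, hτ, hlim⟩ := lim_lemma hS hD hV0 hψ hVψ hηp.le (hα.pos hη')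
  obtain ⟨δ, hδ, hcl⟩ := hic (min (ε / 2) (η / 2)) (by positivity) (max τ 1) (by positivity)
  have hz0 : ∀ x : X, ‖x‖ ≤ η → ∀ t, 0 ≤ t → ‖φ t x (fun _ => 0)‖ ≤ min ε r / 2 :=
    fun x hx => hη x (hx.trans (min_le_left _ _))
  have hmin1 : min ε r ≤ ε := min_le_left _ _
  have hmin2 : min ε r ≤ r := min_le_right _ _
  have hdiff : ∀ x : X, ‖x‖ ≤ η → ∀ u : ℝ → U, PCin u → pcNorm u ≤ δ → ∀ t ∈ Icc 0 (max τ 1),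
      ‖φ t x u - φ t x (fun _ => 0)‖ ≤ min (ε / 2) (η / 2) := fun x hx u hu hun =>
    hcl x (hx.trans (min_le_right _ _)) (fun t ht => (hz0 x hx t ht).trans (by linarith)) u hu hun
  have main := return_lemma hS (ρ := η) (b := δ) (M := ε) (τ := max τ 1) (fun x hx u hu hun => by
      refine ⟨max τ 1, le_max_right _ _, le_rfl, ?_⟩
      have h1 := hdiff x hx u hu hun (max τ 1) ⟨by positivity, le_rfl⟩
      have h2 : ‖φ (max τ 1) x (fun _ => 0)‖ ≤ η / 2 := by
        obtain ⟨t, ht, ht2⟩ := hlim x hx _ hz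
        rw [pcNorm_zero, hσ.2.2, zero_add] at ht2
        have ht3 := hα.le_of_le (norm_nonneg _) hη'.le ht2
        have htm : t ≤ max τ 1 := ht.2.trans (le_max_left _ _)
        have h4 := hη2 _ ht3 (max τ 1 - t) (by linarith)
        have hc := hS.coc x _ hz t (max τ 1 - t) ht.1 (by linarith)
        rw [shift_zero_input, add_sub_cancel] at hc
        rwa [← hc] at h4
      have h3 := norm_le_norm_sub_add (φ (max τ 1) x u) (φ (max τ 1) x (fun _ => 0))
      have h5 : min (ε / 2) (η / 2) ≤ η / 2 := min_le_right _ _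
      linarith)
    (fun x hx u hu hun t ht => by
      have h1 := hdiff x hx u hu hun t ht
      have h2 := hz0 x hx t ht.1
      have h3 := norm_le_norm_sub_add (φ t x u) (φ t x (fun _ => 0))
      have h5 : min (ε / 2) (η / 2) ≤ ε / 2 := min_le_left _ _
      linarith)
  refine ⟨min η δ, by positivity, fun x hx u hu hun => ?_⟩
  exact main x (hx.trans (min_le_left _ _)) u hu (hun.trans (min_le_right _ _))

lemma glob_bdd (hS : Sys φ) (hD : Decr φ V α σ) (hV0 : ∀ x, 0 ≤ V x) (hψ : ClassK ψ)
    (hα : ClassKinf α) (hσ : ClassK σ) (hVψ : ∀ x, V x ≤ ψ ‖x‖) (hBRS : pBRS φ)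
    {C : ℝ} (hC : 0 < C) :
    ∃ M, ∀ x : X, ‖x‖ ≤ C → ∀ u : ℝ → U, PCin u → pcNorm u ≤ C → ∀ t, 0 ≤ t → ‖φ t x u‖ ≤ M := by
  obtain ⟨ρ0, hρ0, hρ1⟩ := hα.2 (σ C + 1)
  set ρ := max ρ0 C with hρ
  have hρC : C ≤ ρ := le_max_right _ _
  have hρα : σ C + 1 ≤ α ρ := hρ1.trans (hα.1.mono hρ0 (le_max_left _ _))
  have hρp : 0 < ρ := by linarith
  obtain ⟨M1, hM1⟩ := hBRS ρ hρp 1 one_pos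
  obtain ⟨τ, hτ, hlim⟩ := lim_lemma hS hD hV0 hψ hVψ (R := max M1 0) (le_max_right _ _) one_pos
  obtain ⟨M, hM⟩ := hBRS ρ hρp (1 + τ) (by positivity)
  have main := return_lemma hS (ρ := ρ) (b := C) (M := M) (τ := 1 + τ) (fun x hx u hu hun => by
      have h1 := hM1 x hx u hu (hun.trans hρC) 1 ⟨zero_le_one, le_rfl⟩
      obtain ⟨t, ht, ht2⟩ := hlim _ (h1.trans (le_max_left _ _)) _ (hu.shift zero_le_one)
      refine ⟨1 + t, by linarith [ht.1], by linarith [ht.2], ?_⟩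
      rw [hS.coc x u hu 1 t zero_le_one ht.1]
      refine hα.1.le_of_le (norm_nonneg _) hρp.le ?_
      have h3 := hσ.mono (pcNorm_nonneg _) ((hu.shift_norm zero_le_one).trans hun)
      linarith)
    (fun x hx u hu hun => hM x hx u hu (hun.trans hρC))
  exact ⟨M, fun x hx u hu hun => main x (hx.trans hρC) u hu hun⟩

lemma ugs (hl : ∀ ε, 0 < ε → ∃ δ, 0 < δ ∧ ∀ x : X, ‖x‖ ≤ δ → ∀ u : ℝ → U, PCin u →
      pcNorm u ≤ δ → ∀ t, 0 ≤ t → ‖φ t x u‖ ≤ ε)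
    (hg : ∀ C, 0 < C → ∃ M, ∀ x : X, ‖x‖ ≤ C → ∀ u : ℝ → U, PCin u →
      pcNorm u ≤ C → ∀ t, 0 ≤ t → ‖φ t x u‖ ≤ M) :
    ∃ θ, ClassKinf θ ∧ ∀ x : X, ∀ u : ℝ → U, PCin u → ∀ t, 0 ≤ t →
      ‖φ t x u‖ ≤ θ ‖x‖ + θ (pcNorm u) := by
  obtain ⟨θ, hθ, h⟩ := exists_Kinf_bound
    (ι := {i : X × (ℝ → U) × ℝ // PCin i.2.1 ∧ 0 ≤ i.2.2})
    (fun i => max ‖i.1.1‖ (pcNorm i.1.2.1)) (fun i => ‖φ i.1.2.2 i.1.1 i.1.2.1‖)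
    (fun i => (norm_nonneg _).trans (le_max_left _ _))
    (fun C hC => by
      obtain ⟨M, hM⟩ := hg C hC
      exact ⟨M, fun i hi => hM _ ((le_max_left _ _).trans hi) _ i.2.1
        ((le_max_right _ _).trans hi) _ i.2.2⟩)
    (fun ε hε => by
      obtain ⟨M, hM0, hM⟩ := hl ε hε
      exact ⟨M, hM0, fun i hi => hM _ ((le_max_left _ _).trans hi) _ i.2.1
        ((le_max_right _ _).trans hi) _ i.2.2⟩)
  refine ⟨θ, hθ, fun x u hu t ht => ?_⟩
  have := h ⟨(x, u, t), hu, ht⟩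
  simp only at this
  refine this.trans ?_
  have h1 := hθ.1.nonneg (norm_nonneg x)
  have h2 := hθ.1.nonneg (pcNorm_nonneg u)
  rcases le_total ‖x‖ (pcNorm u) with h | h
  · rw [max_eq_right h]; linarith
  · rw [max_eq_left h]; linarith

lemma exists_kappa (hα : ClassKinf α) (hσ : ClassK σ) :
    ∃ κ, ClassKinf κ ∧ ∀ r c, 0 ≤ r → 0 ≤ c → α r ≤ 2 * σ c → r ≤ κ c := by
  obtain ⟨κ, hκ, h⟩ := exists_Kinf_bound
    (ι := {i : ℝ × ℝ // 0 ≤ i.1 ∧ 0 ≤ i.2 ∧ α i.1 ≤ 2 * σ i.2})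
    (fun i => i.1.2) (fun i => i.1.1) (fun i => i.2.2.1)
    (fun C hC => by
      obtain ⟨M, hM0, hM⟩ := hα.2 (2 * σ C)
      refine ⟨M, fun i hi => hα.1.le_of_le i.2.1 hM0 ?_⟩
      have := hσ.mono i.2.2.1 hi
      linarith [i.2.2.2])
    (fun ε hε => by
      obtain ⟨δ, hδ, h⟩ := hσ.small (ε := α ε / 2) (by have := hα.1.pos hε; positivity)
      refine ⟨δ, hδ, fun i hi => hα.1.le_of_le i.2.1 hε.le ?_⟩
      have := h _ i.2.2.1 hi
      linarith [i.2.2.2])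
  exact ⟨κ, hκ, fun r c hr hc hrc => h ⟨(r, c), hr, hc, hrc⟩⟩

lemma uag (hS : Sys φ) (hD : Decr φ V α σ) (hV0 : ∀ x, 0 ≤ V x) (hψ : ClassK ψ)
    (hα : ClassKinf α) (hσ : ClassK σ) (hVψ : ∀ x, V x ≤ ψ ‖x‖) {θ κ : ℝ → ℝ}
    (hθ : ClassK θ) (hκ : ClassK κ) (hαθ : ∀ x : X, ∀ u : ℝ → U, PCin u → ∀ t, 0 ≤ t →
      ‖φ t x u‖ ≤ θ ‖x‖ + θ (pcNorm u))
    (hk : ∀ r c, 0 ≤ r → 0 ≤ c → α r ≤ 2 * σ c → r ≤ κ c) {ε R : ℝ} (hε : 0 < ε) (hR : 0 ≤ R) :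
    ∃ τ, 0 < τ ∧ ∀ x : X, ‖x‖ ≤ R → ∀ u : ℝ → U, PCin u → ∀ t, τ ≤ t →
      ‖φ t x u‖ ≤ ε + (θ (κ (pcNorm u)) + θ (pcNorm u)) := by
  obtain ⟨r0, hr0, hr1⟩ := hθ.small hε
  have hαr := hα.1.pos hr0
  obtain ⟨τ, hτ, hlim⟩ := lim_lemma (σ := σ) hS hD hV0 hψ hVψ hR (show 0 < α r0 / 2 by positivity)
  refine ⟨τ, hτ, fun x hx u hu t ht => ?_⟩
  obtain ⟨s, hs, hs2⟩ := hlim x hx u hu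
  have hst : 0 ≤ t - s := by linarith [hs.2]
  have hu0 := pcNorm_nonneg u
  have hc := hS.coc x u hu s (t - s) hs.1 hst
  rw [add_sub_cancel] at hc
  have h1 := hαθ (φ s x u) _ (hu.shift hs.1) (t - s) hst
  rw [← hc] at h1
  have h2 := hθ.mono (pcNorm_nonneg _) (hu.shift_norm hs.1)
  have h3 : θ ‖φ s x u‖ ≤ ε + θ (κ (pcNorm u)) := by
    have hk0 := hκ.nonneg hu0
    have hθk := hθ.nonneg hk0
    rcases le_total (α r0 / 2) (σ (pcNorm u)) with h | h
    · have := hk _ _ (norm_nonneg (φ s x u)) hu0 (by linarith)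
      have := hθ.mono (norm_nonneg _) this
      linarith
    · have := hα.1.le_of_le (norm_nonneg (φ s x u)) hr0.le (by linarith)
      have := hr1 _ (norm_nonneg _) this
      linarith
  linarith

end

lemma ClassK.gain {θ κ : ℝ → ℝ} (hθ : ClassK θ) (hκ : ClassK κ) :
    ClassK (fun s => θ (κ s) + θ s) := by
  have hmaps : MapsTo κ (Ici 0) (Ici 0) := fun s hs => mem_Ici.2 (hκ.nonneg hs)
  refine ⟨(hθ.1.comp hκ.1 hmaps).add hθ.1, ?_, by simp [hκ.2.2, hθ.2.2]⟩
  intro a ha b hb hab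
  exact add_lt_add (hθ.2.1 (hmaps ha) (hmaps hb) (hκ.2.1 ha hb hab)) (hθ.2.1 ha hb hab)

/-- the KL function built from `θ` and `ω` -/
lemma KL_build {θ ω : ℝ → ℝ} (hθ : ClassK θ) (hω : ClassK ω) :
    ClassKL (fun r t => Real.sqrt (θ r * ((1 + r) * (1 + θ r)) * ω (Real.exp (-t)))) := by
  have hωp : ∀ t, 0 < ω (Real.exp (-t)) := fun t => hω.pos (Real.exp_pos _)
  have hωc : Continuous (fun t => ω (Real.exp (-t))) := by
    have := hω.1.comp_continuous (f := fun t => Real.exp (-t)) (by fun_prop)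
      (fun t => mem_Ici.2 (Real.exp_pos _).le)
    exact this
  set G : ℝ → ℝ := fun r => θ r * ((1 + r) * (1 + θ r)) with hG
  have hGc : ContinuousOn G (Ici 0) :=
    hθ.1.mul ((continuousOn_const.add continuousOn_id).mul (continuousOn_const.add hθ.1))
  have hG0 : ∀ r, 0 ≤ r → 0 ≤ G r := fun r hr => by
    have := hθ.nonneg hr
    simp only [hG]; positivity
  have hGp : ∀ r, 0 < r → 0 < G r := fun r hr => by
    have := hθ.pos hr
    simp only [hG]; positivity
  have hGm : StrictMonoOn G (Ici 0) := by
    intro a ha b hb hab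
    have h1 := hθ.2.1 ha hb hab
    have h2 := hθ.nonneg ha
    have ha' : 0 ≤ a := ha
    simp only [hG]
    have h3 : (1 + a) * (1 + θ a) ≤ (1 + b) * (1 + θ b) := by
      have hb0 : 0 ≤ b := hb
      gcongr
    exact mul_lt_mul h1 h3 (by positivity) (by linarith)
  refine ⟨?_, ?_, ?_⟩
  · refine Real.continuous_sqrt.comp_continuousOn ?_
    refine ContinuousOn.mul ?_ (hωc.comp continuous_snd).continuousOn
    exact hGc.comp continuous_fst.continuousOn fun p hp => hp.1
  · intro t ht
    refine ⟨?_, ?_, by simp [hθ.2.2]⟩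
    · exact Real.continuous_sqrt.comp_continuousOn (hGc.mul continuousOn_const)
    · intro a ha b hb hab
      refine Real.sqrt_lt_sqrt (mul_nonneg (hG0 a ha) (hωp t).le) ?_
      exact mul_lt_mul_of_pos_right (hGm ha hb hab) (hωp t)
  · intro r hr
    refine ⟨?_, ?_⟩
    · intro a ha b hb hab
      refine Real.sqrt_lt_sqrt (mul_nonneg (hG0 r hr.le) (hωp b).le) ?_
      refine mul_lt_mul_of_pos_left ?_ (hGp r hr)
      refine hω.2.1 (mem_Ici.2 (Real.exp_pos _).le) (mem_Ici.2 (Real.exp_pos _).le) ?_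
      exact Real.exp_lt_exp.2 (by linarith)
    · have h1 : Tendsto (fun t : ℝ => Real.exp (-t)) atTop (nhdsWithin 0 (Ici 0)) :=
        tendsto_nhdsWithin_iff.2 ⟨Real.tendsto_exp_neg_atTop_nhds_zero,
          Eventually.of_forall fun t => mem_Ici.2 (Real.exp_pos _).le⟩
      have h2 : Tendsto ω (nhdsWithin 0 (Ici 0)) (nhds 0) := by
        have := hω.1 0 (mem_Ici.2 le_rfl)
        rwa [ContinuousWithinAt, hω.2.2] at this
      have h3 := ((h2.comp h1).const_mul (G r)).sqrt
      simpa using h3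

lemma iss_of_uag {φ : ℝ → X → (ℝ → U) → X} {θ γ : ℝ → ℝ} (hθ : ClassK θ) (hγ : ClassK γ)
    (h1 : ∀ x : X, ∀ u : ℝ → U, PCin u → ∀ t, 0 ≤ t → ‖φ t x u‖ ≤ θ ‖x‖ + γ (pcNorm u))
    (h2 : ∀ ε R : ℝ, 0 < ε → 0 ≤ R → ∃ τ, 0 < τ ∧ ∀ x : X, ‖x‖ ≤ R → ∀ u : ℝ → U, PCin u →
      ∀ t, τ ≤ t → ‖φ t x u‖ ≤ ε + γ (pcNorm u)) : pISS φ := by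
  have hA1 : ∀ x : X, 1 ≤ (1 + ‖x‖) * (1 + θ ‖x‖) := fun x => by
    have := hθ.nonneg (norm_nonneg x)
    have := norm_nonneg x
    nlinarith [mul_nonneg (norm_nonneg x) (hθ.nonneg (norm_nonneg x))]
  obtain ⟨ω, hω, h⟩ := exists_Kinf_bound
    (ι := {i : X × (ℝ → U) × ℝ // PCin i.2.1 ∧ 0 ≤ i.2.2})
    (fun i => Real.exp (-i.1.2.2))
    (fun i => (‖φ i.1.2.2 i.1.1 i.1.2.1‖ - γ (pcNorm i.1.2.1)) /
      ((1 + ‖i.1.1‖) * (1 + θ ‖i.1.1‖)))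
    (fun i => (Real.exp_pos _).le)
    (fun C hC => ⟨1, fun i hi => by
      have hb := h1 i.1.1 i.1.2.1 i.2.1 i.1.2.2 i.2.2
      have hA := hA1 i.1.1
      have h3 := hθ.nonneg (norm_nonneg i.1.1)
      rw [div_le_one (by linarith)]
      nlinarith [norm_nonneg i.1.1, mul_nonneg (norm_nonneg i.1.1) h3]⟩)
    (fun ε hε => by
      obtain ⟨τ, hτ, h⟩ := h2 ε (1 / ε) hε (by positivity)
      refine ⟨Real.exp (-τ), Real.exp_pos _, fun i hi => ?_⟩
      have ht : τ ≤ i.1.2.2 := by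
        have := Real.exp_le_exp.1 hi
        linarith
      have hb := h1 i.1.1 i.1.2.1 i.2.1 i.1.2.2 i.2.2
      have hA := hA1 i.1.1
      have h3 := hθ.nonneg (norm_nonneg i.1.1)
      rw [div_le_iff₀ (by linarith)]
      rcases le_total ‖i.1.1‖ (1 / ε) with hx | hx
      · have := h i.1.1 hx i.1.2.1 i.2.1 _ ht
        nlinarith
      · have hx2 : 1 ≤ ε * (1 + ‖i.1.1‖) := by
          rw [div_le_iff₀ hε] at hx
          nlinarith
        rw [← mul_assoc]
        nlinarith)
  refine ⟨_, γ, KL_build hθ hω.1, hγ, fun x u hu t ht => ?_⟩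
  have hb := h1 x u hu t ht
  have hw := h ⟨(x, u, t), hu, ht⟩
  simp only at hw
  have hA := hA1 x
  rw [div_le_iff₀ (by linarith)] at hw
  rw [← sub_le_iff_le_add]
  rcases le_total (‖φ t x u‖ - γ (pcNorm u)) 0 with h0 | h0
  · exact h0.trans (Real.sqrt_nonneg _)
  · refine Real.le_sqrt_of_sq_le ?_
    rw [sq]
    calc _ ≤ θ ‖x‖ * (ω (Real.exp (-t)) * ((1 + ‖x‖) * (1 + θ ‖x‖))) :=
          mul_le_mul (by linarith) hw h0 (hθ.nonneg (norm_nonneg x))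
      _ = _ := by ring

/-- If a semilinear evolution equation satisfying Assumption 1 and property `◊` is BRS
and possesses a non-coercive ISS Lyapunov function, then it is ISS. -/
theorem evolution_ISS_of_nonCoerciveISSLyapunov
    (Tg : C0Semigroup X) (f : X → U → X)
    (hA1 : Assumption1 f) (hd : PropertyDiamond f)
    (φ : ℝ → X → (ℝ → U) → X) (hφ : IsMildFlow Tg f φ)
    (hBRS : pBRS φ) (V : X → ℝ) (hV : pNonCoerciveISSLyapunov φ V) :
    pISS φ := by
  obtain ⟨hVc, hV0, ψ, α, σ, hψ, hα, hσ, -, hVψ, hDini⟩ := hV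
  have hS : Sys φ := ⟨fun x u hu => (hφ x u hu).2, fun x u hu => flow_zero hφ x hu,
    fun x u hu a b ha hb => cocycle hA1 hφ x hu ha hb⟩
  have hD : Decr φ V α σ := decr_of_dini hS hVc hσ hDini
  obtain ⟨θ, hθ, hθ2⟩ := ugs (φ := φ)
    (fun ε hε => local_stab hS hD hV0 hψ.1 hα.1 hσ hVψ
      (fun ε hε => zero_cep hA1 hφ hBRS hε one_pos) (input_cont hA1 hd hφ hBRS) hε)
    (fun C hC => glob_bdd hS hD hV0 hψ.1 hα hσ hVψ hBRS hC)
  obtain ⟨κ, hκ, hκ2⟩ := exists_kappa hα hσ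
  refine iss_of_uag hθ.1 (hθ.1.gain hκ.1) (fun x u hu t ht => ?_)
    (fun ε R hε hR => uag hS hD hV0 hψ.1 hα hσ hVψ hθ.1 hκ.1 hθ2 hκ2 hε hR)
  have := hθ2 x u hu t ht
  have := hθ.1.nonneg (hκ.1.nonneg (pcNorm_nonneg u))
  linarith
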